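/- arXiv:2110.15406 — 2 statements merged into one kernel-verified Lean document; each statement's English description precedes it below -/
import Mathlib

section
/- Fix n ≥ 1, a covariate matrix X ∈ ℝ^{n×d}, group labels Z ∈ {1,…,H}ⁿ, a measurable function f₀ : ℝᵈ → ℝ, and σ₀ > 0, and suppose Y = f₀(X) + ε with f₀(X) = (f₀(X_1),…,f₀(X_n))ᵀ and ε ~ N(0, σ₀² I_n). Fix a symmetric positive semidefinite kernel K, a permutation size b ∈ {1,…,n}, any test statistic T, and α₀ ∈ (0,1). Define the left-over signal proportion ω(b, σ₀⁻¹f₀) = σ₀⁻² Σ_{i=n−b+1}^n (γ_iᵀ f₀(X))² and the correction v(b, σ₀⁻¹f₀, α₀) = (1/2)·exp{2·√(2·ω(b, σ₀⁻¹f₀))·√(Q_b(1−α₀) + ω(b, σ₀⁻¹f₀))} − 1/2. Then the corrected partial permutation p-value p_c(X,Y,Z) = p(X,Y,Z) + v(b, σ₀⁻¹f₀, α₀) + α₀ (with p either the discrete or the continuous partial permutation p-value) is valid: Pr(p_c(X,Y,Z) ≤ α) ≤ α for every α ∈ (0,1). -/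
open MeasureTheory ProbabilityTheory Filter

noncomputable section

namespace PPT

/-- The law of `k` i.i.d. standard Gaussian random variables. -/
def stdGaussianPi (k : ℕ) : Measure (Fin k → ℝ) :=
  Measure.pi fun _ => gaussianReal 0 1

/-- The law of `n` i.i.d. centered Gaussian noises with standard deviation `σ`. -/
def noiseLaw (n : ℕ) (σ : ℝ) : Measure (Fin n → ℝ) :=
  Measure.pi fun _ => gaussianReal 0 ((σ ^ 2).toNNReal)

/-- Matrix (given as a function) times vector. -/
def mulVecF {n m : ℕ} (A : Fin n → Fin m → ℝ) (v : Fin m → ℝ) : Fin n → ℝ :=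
  fun i => ∑ j, A i j * v j

/-- Transposed matrix times vector, `Aᵀ v`. -/
def tmulVecF {n : ℕ} (A : Fin n → Fin n → ℝ) (v : Fin n → ℝ) : Fin n → ℝ :=
  fun i => ∑ j, A j i * v j

/-- Matrix product of matrices given as functions. -/
def mulF {n : ℕ} (A B : Fin n → Fin n → ℝ) : Fin n → Fin n → ℝ :=
  fun i j => ∑ k, A i k * B k j

/-- The identity matrix as a function. -/
def idF (n : ℕ) : Fin n → Fin n → ℝ :=
  fun i j => if i = j then 1 else 0

/-- Quadratic form `vᵀ A v`. -/
def quadForm {n : ℕ} (A : Fin n → Fin n → ℝ) (v : Fin n → ℝ) : ℝ :=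
  ∑ i, ∑ j, v i * A i j * v j

/-- `A` is an orthogonal matrix: `A Aᵀ = I`. -/
def IsOrthogonalF {n : ℕ} (A : Fin n → Fin n → ℝ) : Prop :=
  ∀ i j, (∑ k, A i k * A j k) = if i = j then (1 : ℝ) else 0

/-- `(Γ, c)` is an eigendecomposition `Kmat = Γ diag(c) Γᵀ` of `Kmat`, with `Γ` orthogonal and
the eigenvalues `c` nonnegative and in nonincreasing order. -/
def IsEigenDecomp {n : ℕ} (Kmat Γ : Fin n → Fin n → ℝ) (c : Fin n → ℝ) : Prop :=
  IsOrthogonalF Γ ∧ (∀ i j, Kmat i j = ∑ k, Γ i k * c k * Γ j k) ∧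
    (∀ i j : Fin n, i ≤ j → c j ≤ c i) ∧ (∀ i, 0 ≤ c i)

/-- A symmetric positive semidefinite kernel on `ℝᵈ`. -/
def IsPSDKernel {d : ℕ} (K : (Fin d → ℝ) → (Fin d → ℝ) → ℝ) : Prop :=
  (∀ x y, K x y = K y x) ∧
    ∀ (m : ℕ) (v : Fin m → (Fin d → ℝ)) (a : Fin m → ℝ),
      0 ≤ ∑ i, ∑ j, a i * a j * K (v i) (v j)

/-- The set `M(n,b)` of permutations of `{0, …, n-1}` keeping the first `n - b` elements fixed. -/
def permSet (n b : ℕ) : Finset (Equiv.Perm (Fin n)) :=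
  Finset.univ.filter fun ψ => ∀ i : Fin n, (i : ℕ) < n - b → ψ i = i

/-- The discrete partial permutation p-value, with covariates `X`, group labels `Z`,
test statistic `T`, eigenvector matrix `Γ`, permutation size `b` and responses `Y`. -/
def pDisc {n d H : ℕ} (X : Fin n → Fin d → ℝ) (Z : Fin n → Fin H)
    (T : (Fin n → Fin d → ℝ) → (Fin n → ℝ) → (Fin n → Fin H) → ℝ)
    (Γ : Fin n → Fin n → ℝ) (b : ℕ) (Y : Fin n → ℝ) : ℝ :=
  ((permSet n b).card : ℝ)⁻¹ *
    ∑ ψ ∈ permSet n b,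
      if T X Y Z ≤ T X (mulVecF Γ ((tmulVecF Γ Y) ∘ ψ)) Z then 1 else 0

/-- Squared norm of the last `b` coordinates of a vector in `ℝⁿ`. -/
def tailNormSq {n : ℕ} (b : ℕ) (w : Fin n → ℝ) : ℝ :=
  ∑ i ∈ Finset.univ.filter (fun i : Fin n => n - b ≤ (i : ℕ)), w i ^ 2

/-- The continuous partial permutation of `w` driven by `g`: it agrees with `w` on the first
`n - b` coordinates, and its last `b` coordinates are those of `g` rescaled to lie on the sphere
of radius `(Σ_{i ≥ n-b} w i ^ 2)^{1/2}`.  When `g` is standard Gaussian, the last `b` coordinates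
are uniformly distributed on that sphere. -/
def wStar {n : ℕ} (b : ℕ) (w g : Fin n → ℝ) : Fin n → ℝ := fun i =>
  if (i : ℕ) < n - b then w i
  else Real.sqrt (tailNormSq b w) * g i / Real.sqrt (tailNormSq b g)

/-- The continuous partial permutation p-value. -/
def pCont {n d H : ℕ} (X : Fin n → Fin d → ℝ) (Z : Fin n → Fin H)
    (T : (Fin n → Fin d → ℝ) → (Fin n → ℝ) → (Fin n → Fin H) → ℝ)
    (Γ : Fin n → Fin n → ℝ) (b : ℕ) (Y : Fin n → ℝ) : ℝ :=
  (stdGaussianPi n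
    {g | T X Y Z ≤ T X (mulVecF Γ (wStar b (tmulVecF Γ Y) g)) Z}).toReal

/-- The chi-squared distribution with `k` degrees of freedom, realized as the law of the sum of
squares of `k` independent standard Gaussians. -/
def chiSq (k : ℕ) : Measure ℝ :=
  Measure.map (fun g : Fin k → ℝ => ∑ i, g i ^ 2) (stdGaussianPi k)

/-- The quantile function of the chi-squared distribution with `k` degrees of freedom. -/
def chiSqQuantile (k : ℕ) (p : ℝ) : ℝ :=
  sInf {x : ℝ | ENNReal.ofReal p ≤ chiSq k (Set.Iic x)}

end PPT


theorem rank_real (lam : Measure ℝ) (t : ENNReal) :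
    lam {s | lam (Set.Ici s) ≤ t} ≤ t := by
  set U : Set ℝ := {s | lam (Set.Ici s) ≤ t} with hU
  have hup : ∀ s ∈ U, ∀ s', s ≤ s' → s' ∈ U := by
    intro s hs s' hss
    exact (measure_mono (Set.Ici_subset_Ici.2 hss)).trans hs
  by_cases hmin : ∃ s ∈ U, ∀ s' ∈ U, s ≤ s'
  · obtain ⟨s, hs, h⟩ := hmin
    exact (measure_mono (fun x hx => h x hx)).trans hs
  · push Not at hmin
    have hsub : U ⊆ ⋃ q : {q : ℚ // (q : ℝ) ∈ U}, Set.Ici ((q : ℚ) : ℝ) := by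
      intro s hs
      obtain ⟨s', hs', hlt⟩ := hmin s hs
      obtain ⟨q, hq1, hq2⟩ := exists_rat_btwn hlt
      exact Set.mem_iUnion.2 ⟨⟨q, hup _ hs' _ hq1.le⟩, hq2.le⟩
    refine (measure_mono hsub).trans ?_
    rw [Directed.measure_iUnion]
    · exact iSup_le fun q => q.2
    · intro q r
      rcases le_total (q : ℚ) (r : ℚ) with h | h
      · exact ⟨q, subset_rfl, Set.Ici_subset_Ici.2 (by exact_mod_cast h)⟩
      · exact ⟨r, Set.Ici_subset_Ici.2 (by exact_mod_cast h), subset_rfl⟩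

theorem rank_gen {Θ : Type*} [MeasurableSpace Θ] (π : Measure Θ) (S : Θ → ℝ) (hS : Measurable S)
    (t : ENNReal) : π {θ | π {θ' | S θ ≤ S θ'} ≤ t} ≤ t := by
  have h := rank_real (π.map S) t
  have h1 : ∀ s, (π.map S) (Set.Ici s) = π {θ' | s ≤ S θ'} := fun s =>
    Measure.map_apply hS measurableSet_Ici
  simp only [h1] at h
  exact (Measure.le_map_apply hS.aemeasurable _).trans h

/-- the elementary tilting inequality -/
theorem tilt_real {q t k v lo I1 I2 : ℝ} (hq0 : 0 ≤ q) (hq1 : q ≤ 1) (hqt : q ≤ t) (hlo : 0 ≤ lo)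
    (hk : 1 ≤ k) (hv : v = (k - 1) / 2) (hI1 : I1 ≤ q * (k * lo)) (hI10 : 0 ≤ I1)
    (hI2 : (1 - q) * lo ≤ I2) : I1 ≤ (t + v) * (I1 + I2) := by
  have hv0 : 0 ≤ v := by linarith
  have hI20 : 0 ≤ I2 := le_trans (mul_nonneg (by linarith) hlo) hI2
  have : I1 ≤ (q + v) * (I1 + I2) := by
    by_cases hc : 1 - q - v ≤ 0
    · nlinarith [mul_nonneg hI20 (add_nonneg hq0 hv0)]
    · push Not at hc
      have hk' : k = 1 + 2 * v := by linarith
      have e1 : I1 * (1 - q - v) ≤ q * (k * lo) * (1 - q - v) :=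
        mul_le_mul_of_nonneg_right hI1 hc.le
      have e2 : (q + v) * ((1 - q) * lo) ≤ (q + v) * I2 :=
        mul_le_mul_of_nonneg_left hI2 (add_nonneg hq0 hv0)
      have e3 : q * k * (1 - q - v) ≤ (q + v) * (1 - q) := by
        subst hk'
        have : 0 ≤ v * (1 - 2 * q * (1 - q) + 2 * q * v) := by
          apply mul_nonneg hv0
          nlinarith [sq_nonneg (q - 1/2), mul_nonneg hq0 hv0]
        nlinarith
      have e4 := mul_le_mul_of_nonneg_right e3 hlo
      nlinarith
  refine this.trans (mul_le_mul_of_nonneg_right (by linarith) (by linarith))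

theorem tilt_pt {Θ : Type*} [MeasurableSpace Θ] (π : Measure Θ) [IsProbabilityMeasure π]
    (l : Θ → ENNReal) (E : Set Θ) (hE : MeasurableSet E)
    (t k lo : ℝ) (hlo : 0 ≤ lo) (hk : 1 ≤ k) (ht : 0 ≤ t)
    (hq : π E ≤ ENNReal.ofReal t)
    (h1 : ∀ᵐ θ ∂π, ENNReal.ofReal lo ≤ l θ) (h2 : ∀ᵐ θ ∂π, l θ ≤ ENNReal.ofReal (k * lo)) :
    ∫⁻ θ in E, l θ ∂π ≤ ENNReal.ofReal (t + (k - 1) / 2) * ∫⁻ θ, l θ ∂π := by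
  have hup : ∀ s : Set Θ, ∫⁻ θ in s, l θ ∂π ≤ ENNReal.ofReal (k * lo) * π s := by
    intro s
    calc _ ≤ ∫⁻ θ in s, ENNReal.ofReal (k * lo) ∂π := lintegral_mono_ae (ae_restrict_of_ae h2)
      _ = _ := by simp
  have hdn : ENNReal.ofReal lo * π Eᶜ ≤ ∫⁻ θ in Eᶜ, l θ ∂π := by
    calc _ = ∫⁻ θ in Eᶜ, ENNReal.ofReal lo ∂π := by simp
      _ ≤ _ := lintegral_mono_ae (ae_restrict_of_ae h1)
  have hfin : ∀ s : Set Θ, ∫⁻ θ in s, l θ ∂π ≠ ⊤ := fun s =>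
    ne_top_of_le_ne_top (ENNReal.mul_ne_top ENNReal.ofReal_ne_top (measure_ne_top _ _)) (hup s)
  rw [← lintegral_add_compl (μ := π) l hE]
  set I1 := ∫⁻ θ in E, l θ ∂π
  set I2 := ∫⁻ θ in Eᶜ, l θ ∂π
  have hc : (π Eᶜ).toReal = 1 - (π E).toReal := by
    have := probReal_compl_eq_one_sub (μ := π) hE
    simpa [Measure.real] using this
  have key := tilt_real (q := (π E).toReal) (t := t) (k := k) (v := (k-1)/2) (lo := lo)
    (I1 := I1.toReal) (I2 := I2.toReal) ENNReal.toReal_nonneg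
    (by simpa [Measure.real] using measureReal_le_one (μ := π) (s := E))
    (ENNReal.toReal_le_of_le_ofReal ht hq) hlo hk rfl
    (by
      have := ENNReal.toReal_mono (ENNReal.mul_ne_top ENNReal.ofReal_ne_top (measure_ne_top _ _)) (hup E)
      rw [ENNReal.toReal_mul, ENNReal.toReal_ofReal (by positivity)] at this
      linarith)
    ENNReal.toReal_nonneg
    (by
      have := ENNReal.toReal_mono (hfin _) hdn
      rw [ENNReal.toReal_mul, ENNReal.toReal_ofReal hlo, hc] at this
      linarith)
  rw [← ENNReal.ofReal_toReal (show I1 ≠ ⊤ from hfin E), ← ENNReal.ofReal_toReal (show I2 ≠ ⊤ from hfin Eᶜ),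
    ← ENNReal.ofReal_add ENNReal.toReal_nonneg ENNReal.toReal_nonneg,
    ← ENNReal.ofReal_mul (by linarith)]
  exact ENNReal.ofReal_le_ofReal key

theorem core {Ω Θ : Type*} [MeasurableSpace Ω] [MeasurableSpace Θ]
    (ν : Measure Ω) (π : Measure Θ) [IsProbabilityMeasure π]
    (act : Ω → Θ → Ω) (hact : Measurable (Function.uncurry act))
    (hinv : ∀ F : Ω → ENNReal, Measurable F →
      ∫⁻ w, F w ∂ν = ∫⁻ w, ∫⁻ θ, F (act w θ) ∂π ∂ν)
    (hfix : ∀ w, ∀ᵐ θ ∂π, ∀ s, MeasurableSet s →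
      π {θ' | act (act w θ) θ' ∈ s} = π {θ' | act w θ' ∈ s})
    (S : Ω → ℝ) (hS : Measurable S) (L : Ω → ENNReal) (hL : Measurable L)
    (B : Set Ω) (hB : MeasurableSet B) (hBinv : ∀ w, ∀ᵐ θ ∂π, (act w θ ∈ B ↔ w ∈ B))
    (k lo : ℝ) (hlo : 0 ≤ lo) (hk : 1 ≤ k)
    (h1 : ∀ w ∈ B, ENNReal.ofReal lo ≤ L w) (h2 : ∀ w ∈ B, L w ≤ ENNReal.ofReal (k * lo))
    (hL1 : ∫⁻ w, L w ∂ν ≤ 1) (t : ℝ) (ht : 0 ≤ t) :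
    ν.withDensity L ({w | π {θ | S w ≤ S (act w θ)} ≤ ENNReal.ofReal t} ∩ B) ≤
      ENNReal.ofReal (t + (k - 1) / 2) := by
  set p : Ω → ENNReal := fun w => π {θ | S w ≤ S (act w θ)} with hp
  have hpm : Measurable p := by
    have hs : MeasurableSet {x : Ω × Θ | S x.1 ≤ S (Function.uncurry act x)} :=
      measurableSet_le (hS.comp measurable_fst) (hS.comp hact)
    exact measurable_measure_prodMk_left hs
  have hE : MeasurableSet {w | p w ≤ ENNReal.ofReal t} := hpm measurableSet_Iic
  set E := {w | p w ≤ ENNReal.ofReal t} with hEdef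
  have haw : ∀ w, Measurable (act w) := fun w => hact.comp measurable_prodMk_left
  rw [withDensity_apply _ (hE.inter hB), ← lintegral_indicator (hE.inter hB),
    hinv _ (hL.indicator (hE.inter hB))]
  calc _ ≤ ∫⁻ w, ENNReal.ofReal (t + (k - 1) / 2) * ∫⁻ θ, L (act w θ) ∂π ∂ν := ?_
    _ = ENNReal.ofReal (t + (k - 1) / 2) * ∫⁻ w, ∫⁻ θ, L (act w θ) ∂π ∂ν := by
        rw [lintegral_const_mul' _ _ ENNReal.ofReal_ne_top]
    _ ≤ _ := by
        rw [← hinv L hL]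
        exact (mul_le_mul_right hL1 _).trans (by simp)
  refine lintegral_mono fun w => ?_
  by_cases hw : w ∈ B
  · have hEw : MeasurableSet {θ | act w θ ∈ E} := haw w hE
    have hq : π {θ | act w θ ∈ E} ≤ ENNReal.ofReal t := by
      have hr := rank_gen π (fun θ => S (act w θ)) (hS.comp (haw w)) (ENNReal.ofReal t)
      refine le_trans (measure_mono_ae ?_) hr
      filter_upwards [hfix w] with θ hθ hmem
      have h3 := hθ {x | S (act w θ) ≤ S x} (measurableSet_le measurable_const hS)
      have : p (act w θ) ≤ ENNReal.ofReal t := hmem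
      simp only [hp] at this
      simp only [Set.mem_ofPred_eq] at h3
      rw [h3] at this
      exact this
    have ht1 := tilt_pt π (fun θ => L (act w θ)) _ hEw t k lo hlo hk ht hq
      (by filter_upwards [hBinv w] with θ hθ using h1 _ (hθ.2 hw))
      (by filter_upwards [hBinv w] with θ hθ using h2 _ (hθ.2 hw))
    refine le_trans ?_ ht1
    rw [← lintegral_indicator hEw]
    refine lintegral_mono fun θ => ?_
    by_cases hm : act w θ ∈ E ∩ B
    · have hm' : θ ∈ {θ | act w θ ∈ E} := hm.1
      rw [Set.indicator_of_mem hm, Set.indicator_of_mem hm']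
    · rw [Set.indicator_of_notMem hm]; exact zero_le
  · have : ∫⁻ θ, (E ∩ B).indicator L (act w θ) ∂π = ∫⁻ θ, 0 ∂π := by
      refine lintegral_congr_ae ?_
      filter_upwards [hBinv w] with θ hθ
      exact Set.indicator_of_notMem (fun h => hw (hθ.1 h.2)) _
    show ∫⁻ θ, (E ∩ B).indicator L (act w θ) ∂π ≤ _
    rw [this]; simp

/-- density of a product of unit variance gaussians -/
theorem pi_gauss_density {ι : Type*} [Fintype ι] (m : ι → ℝ) :
    Measure.pi (fun i => gaussianReal (m i) 1) =
      (volume : Measure (ι → ℝ)).withDensity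
        (fun w => ENNReal.ofReal (∏ i, gaussianPDFReal (m i) 1 (w i))) := by
  refine Measure.pi_eq fun s hs => ?_
  rw [withDensity_apply _ (MeasurableSet.univ_pi hs),
    ← lintegral_indicator (MeasurableSet.univ_pi hs)]
  have h1 : ∀ w : ι → ℝ, (Set.univ.pi s).indicator
      (fun w => ENNReal.ofReal (∏ i, gaussianPDFReal (m i) 1 (w i))) w =
      ENNReal.ofReal (∏ i, (s i).indicator (gaussianPDFReal (m i) 1) (w i)) := by
    intro w
    by_cases hw : w ∈ Set.univ.pi s
    · rw [Set.indicator_of_mem hw]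
      congr 1
      refine Finset.prod_congr rfl fun i _ => ?_
      rw [Set.indicator_of_mem (hw i (Set.mem_univ i))]
    · rw [Set.indicator_of_notMem hw]
      have : ∃ i, w i ∉ s i := by
        by_contra hc
        push Not at hc
        exact hw fun i _ => hc i
      obtain ⟨i, hi⟩ := this
      rw [Finset.prod_eq_zero (Finset.mem_univ i) (Set.indicator_of_notMem hi _)]
      simp
  have hIntg : ∀ i, Integrable ((s i).indicator (gaussianPDFReal (m i) 1)) :=
    fun i => (integrable_gaussianPDFReal _ _).indicator (hs i)
  have hnn : ∀ i x, 0 ≤ (s i).indicator (gaussianPDFReal (m i) 1) x := fun i x =>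
    Set.indicator_nonneg (fun y _ => gaussianPDFReal_nonneg _ _ y) x
  rw [lintegral_congr h1, volume_pi, ← ofReal_integral_eq_lintegral_ofReal (Integrable.fintype_prod hIntg)
    (ae_of_all _ fun w => Finset.prod_nonneg fun i _ => hnn i _),
    integral_fintype_prod_eq_prod,
    ENNReal.ofReal_prod_of_nonneg (fun i _ => integral_nonneg (hnn i))]
  refine Finset.prod_congr rfl fun i _ => ?_
  rw [gaussianReal_apply_eq_integral _ one_ne_zero, integral_indicator (hs i)]

theorem prod_pdf {ι : Type*} [Fintype ι] (m w : ι → ℝ) :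
    ∏ i, gaussianPDFReal (m i) 1 (w i) =
      (∏ _i : ι, (Real.sqrt (2 * Real.pi))⁻¹) * Real.exp (-(∑ i, (w i - m i) ^ 2) / 2) := by
  simp only [gaussianPDFReal, Finset.prod_mul_distrib, NNReal.coe_one, mul_one]
  rw [← Real.exp_sum, ← Finset.sum_div, Finset.sum_neg_distrib]

/-- Cameron-Martin -/
theorem pi_gauss_tilt {ι : Type*} [Fintype ι] (m m' : ι → ℝ) :
    Measure.pi (fun i => gaussianReal (m i) 1) =
      (Measure.pi (fun i => gaussianReal (m' i) 1)).withDensity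
        (fun w => ENNReal.ofReal
          (Real.exp ((∑ i, (w i - m' i) ^ 2) / 2 - (∑ i, (w i - m i) ^ 2) / 2))) := by
  rw [pi_gauss_density m, pi_gauss_density m', ← withDensity_mul]
  · congr 1
    ext w
    rw [Pi.mul_apply, ← ENNReal.ofReal_mul (Finset.prod_nonneg fun i _ => gaussianPDFReal_nonneg _ _ _),
      prod_pdf, prod_pdf, mul_assoc, ← Real.exp_add]
    congr 3
    ring
  · simp only [prod_pdf]; fun_prop
  · fun_prop

/-- polar coordinates -/
theorem polar {E : Type*} [NormedAddCommGroup E] [InnerProductSpace ℝ E] [FiniteDimensional ℝ E]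
    [MeasurableSpace E] [BorelSpace E] [Nontrivial E] (f : E → ENNReal) (hf : Measurable f) :
    ∫⁻ x, f x = ∫⁻ r : Set.Ioi (0 : ℝ), ∫⁻ u : Metric.sphere (0 : E) 1, f ((r : ℝ) • (u : E))
      ∂(volume : Measure E).toSphere ∂(Measure.volumeIoiPow (Module.finrank ℝ E - 1)) := by
  have hm := (volume : Measure E).measurePreserving_homeomorphUnitSphereProd
  have hg : Measurable fun q : Metric.sphere (0 : E) 1 × Set.Ioi (0 : ℝ) =>
      f ((q.2 : ℝ) • (q.1 : E)) := by fun_prop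
  rw [← lintegral_prod_symm (f := fun q : Metric.sphere (0 : E) 1 × Set.Ioi (0 : ℝ) =>
      f ((q.2 : ℝ) • (q.1 : E))) hg.aemeasurable, ← hm.lintegral_comp hg]
  have : ∀ x : ({0}ᶜ : Set E), ((homeomorphUnitSphereProd E x).2 : ℝ) •
      ((homeomorphUnitSphereProd E x).1 : E) = x := by
    intro x
    have hx : ‖(x : E)‖ ≠ 0 := norm_ne_zero_iff.2 x.2
    simp [smul_smul, hx]
  simp only [this]
  rw [lintegral_subtype_comap (measurableSet_singleton _).compl, restrict_compl_singleton]

/-- resampling the direction of a spherically symmetric law -/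
theorem polar_resample {E : Type*} [NormedAddCommGroup E] [InnerProductSpace ℝ E]
    [FiniteDimensional ℝ E]
    [MeasurableSpace E] [BorelSpace E] [Nontrivial E] (φ : ℝ → ENNReal) (hφ : Measurable φ)
    (h1 : ∫⁻ x : E, φ ‖x‖ = 1) (F : E → ENNReal) (hF : Measurable F) :
    ∫⁻ x : E, φ ‖x‖ * ∫⁻ y : E, φ ‖y‖ * F (‖x‖ • ‖y‖⁻¹ • y) = ∫⁻ x : E, φ ‖x‖ * F x := by
  set sg := (volume : Measure E).toSphere
  set rho := Measure.volumeIoiPow (Module.finrank ℝ E - 1)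
  set C := ∫⁻ r : Set.Ioi (0:ℝ), φ (r : ℝ) ∂rho
  have hn : ∀ (r : Set.Ioi (0:ℝ)) (u : Metric.sphere (0:E) 1), ‖(r : ℝ) • (u : E)‖ = r := by
    intro r u
    have := r.2
    simp only [Set.mem_Ioi] at this
    simp [norm_smul, abs_of_pos this]
  set H : ℝ → ENNReal := fun s => ∫⁻ u : Metric.sphere (0:E) 1, F (s • (u:E)) ∂sg with hHdef
  have hH : Measurable H := by
    have : Measurable fun q : ℝ × Metric.sphere (0:E) 1 => F (q.1 • (q.2 : E)) := by fun_prop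
    exact this.lintegral_prod_right'
  have hFm : ∀ s : ℝ, Measurable fun u : Metric.sphere (0:E) 1 => F (s • (u:E)) := by
    intro s; fun_prop
  have hin : ∀ s : ℝ, ∫⁻ y : E, φ ‖y‖ * F (s • ‖y‖⁻¹ • y) = C * H s := by
    intro s
    rw [polar _ (by fun_prop)]
    simp only [hn]
    have : ∀ (r : Set.Ioi (0:ℝ)) (u : Metric.sphere (0:E) 1),
        (r : ℝ)⁻¹ • (r : ℝ) • (u : E) = u := by
      intro r u
      rw [smul_smul, inv_mul_cancel₀ (ne_of_gt r.2), one_smul]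
    simp only [this]
    have h2 : ∀ r : Set.Ioi (0:ℝ), ∫⁻ u : Metric.sphere (0:E) 1, φ (r:ℝ) * F (s • (u:E)) ∂sg =
        φ (r:ℝ) * H s := fun r => lintegral_const_mul _ (hFm s)
    simp only [sg] at h2 ⊢
    simp only [h2]
    rw [lintegral_mul_const _ (by fun_prop)]
  have hC : C * sg Set.univ = 1 := by
    rw [← h1, polar _ (by fun_prop)]
    simp only [hn, lintegral_const]
    rw [lintegral_mul_const _ (by fun_prop)]
  simp only [hin]
  rw [polar _ (by fun_prop), polar (fun x => φ ‖x‖ * F x) (by fun_prop)]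
  simp only [hn, lintegral_const]
  calc _ = ∫⁻ r : Set.Ioi (0:ℝ), φ r * H r ∂rho := by
        refine lintegral_congr fun r => ?_
        calc _ = φ r * H r * (C * sg Set.univ) := by ring
          _ = _ := by rw [hC, mul_one]
    _ = _ := by
        refine lintegral_congr fun r => ?_
        exact (lintegral_const_mul _ (hFm r)).symm

theorem gauss_resample {ι : Type*} [Fintype ι] [Nonempty ι] (F : (ι → ℝ) → ENNReal)
    (hF : Measurable F) :
    ∫⁻ x, ∫⁻ y, F (fun i => Real.sqrt (∑ j, x j ^ 2) * y i / Real.sqrt (∑ j, y j ^ 2))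
      ∂(Measure.pi fun _ : ι => gaussianReal 0 1) ∂(Measure.pi fun _ : ι => gaussianReal 0 1)
    = ∫⁻ x, F x ∂(Measure.pi fun _ : ι => gaussianReal 0 1) := by
  set φ : ℝ → ENNReal := fun r => ENNReal.ofReal
    ((∏ _i : ι, (Real.sqrt (2 * Real.pi))⁻¹) * Real.exp (-(r^2) / 2)) with hφdef
  have hφ : Measurable φ := by fun_prop
  have hvp := EuclideanSpace.volume_preserving_symm_measurableEquiv_toLp ι
  have hnorm : ∀ x : EuclideanSpace ℝ ι, Real.sqrt (∑ j, x j ^ 2) = ‖x‖ := fun x => by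
    rw [EuclideanSpace.norm_eq]; simp
  have key : ∀ G : (ι → ℝ) → ENNReal, Measurable G →
      ∫⁻ x, G x ∂(Measure.pi fun _ : ι => gaussianReal 0 1) =
      ∫⁻ x : EuclideanSpace ℝ ι, φ ‖x‖ * G (fun i => x i) := by
    intro G hG
    rw [pi_gauss_density (fun _ : ι => (0:ℝ)),
      lintegral_withDensity_eq_lintegral_mul _ (by simp only [prod_pdf]; fun_prop) hG,
      ← hvp.lintegral_comp (by simp only [prod_pdf]; fun_prop)]
    refine lintegral_congr fun x => ?_
    simp only [Pi.mul_apply, prod_pdf, hφdef, EuclideanSpace.norm_sq_eq, Real.norm_eq_abs, sq_abs,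
      sub_zero]
    rfl
  have hjm : Measurable fun q : (ι → ℝ) × (ι → ℝ) => F (fun i => Real.sqrt (∑ j, q.1 j ^ 2) * q.2 i / Real.sqrt (∑ j, q.2 j ^ 2)) := by
    refine hF.comp ?_
    rw [measurable_pi_iff]; intro i; fun_prop
  rw [key _ hjm.lintegral_prod_right', key F hF]
  have h1 : ∫⁻ x : EuclideanSpace ℝ ι, φ ‖x‖ = 1 := by
    have := key (fun _ => 1) measurable_const
    simpa using this.symm
  have := polar_resample φ hφ h1 (fun x : EuclideanSpace ℝ ι => F (fun i => x i)) (by fun_prop)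
  rw [← this]
  refine lintegral_congr fun x => ?_
  congr 1
  rw [key _ (by
    refine hF.comp ?_
    rw [measurable_pi_iff]; intro i; fun_prop)]
  refine lintegral_congr fun y => ?_
  congr 2
  ext i
  rw [hnorm, hnorm]
  simp only [PiLp.smul_apply, smul_eq_mul]
  ring
namespace PPT

/-- the mean with its tail removed -/
def headMean {n : ℕ} (b : ℕ) (m : Fin n → ℝ) : Fin n → ℝ := fun i =>
  if (i : ℕ) < n - b then m i else 0

theorem tail_cs {n : ℕ} (b : ℕ) (w m : Fin n → ℝ) :
    |∑ i ∈ Finset.univ.filter (fun i : Fin n => n - b ≤ (i : ℕ)), w i * m i| ≤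
      Real.sqrt (tailNormSq b w) * Real.sqrt (tailNormSq b m) := by
  have hw : 0 ≤ tailNormSq b w := Finset.sum_nonneg fun i _ => sq_nonneg _
  rw [← Real.sqrt_mul hw]
  apply Real.abs_le_sqrt
  exact Finset.sum_mul_sq_le_sq_mul_sq _ _ _

theorem tilt_exponent {n : ℕ} (b : ℕ) (w m : Fin n → ℝ) :
    (∑ i, (w i - headMean b m i) ^ 2) / 2 - (∑ i, (w i - m i) ^ 2) / 2 =
      (∑ i ∈ Finset.univ.filter (fun i : Fin n => n - b ≤ (i : ℕ)), w i * m i)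
        - tailNormSq b m / 2 := by
  rw [tailNormSq, Finset.sum_filter, Finset.sum_filter, Finset.sum_div, Finset.sum_div,
    Finset.sum_div, ← Finset.sum_sub_distrib, ← Finset.sum_sub_distrib]
  refine Finset.sum_congr rfl fun i _ => ?_
  unfold headMean
  by_cases h : (i : ℕ) < n - b
  · have h' : ¬ (n - b ≤ (i : ℕ)) := by omega
    simp [h, h']
  · have h' : (n - b ≤ (i : ℕ)) := by omega
    simp only [h, h', if_true, if_false]
    ring

theorem measurable_tailNormSq {n : ℕ} (b : ℕ) :
    Measurable (tailNormSq b : (Fin n → ℝ) → ℝ) := by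
  unfold tailNormSq; fun_prop

theorem main_abs {n b : ℕ} (m : Fin n → ℝ) {Θ : Type*} [MeasurableSpace Θ]
    (π : Measure Θ) [IsProbabilityMeasure π]
    (act : (Fin n → ℝ) → Θ → (Fin n → ℝ)) (hact : Measurable (Function.uncurry act))
    (hinv : ∀ F : (Fin n → ℝ) → ENNReal, Measurable F →
      ∫⁻ w, F w ∂(Measure.pi fun i => gaussianReal (headMean b m i) 1) =
      ∫⁻ w, ∫⁻ θ, F (act w θ) ∂π ∂(Measure.pi fun i => gaussianReal (headMean b m i) 1))
    (hfix : ∀ w, ∀ᵐ θ ∂π, ∀ s, MeasurableSet s →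
      π {θ' | act (act w θ) θ' ∈ s} = π {θ' | act w θ' ∈ s})
    (hnorm : ∀ w, ∀ᵐ θ ∂π, tailNormSq b (act w θ) = tailNormSq b w)
    (S : (Fin n → ℝ) → ℝ) (hS : Measurable S)
    (Q α0 : ℝ) (hα0 : 0 ≤ α0) (hQ : stdGaussianPi n {g | Q < tailNormSq b g} ≤ ENNReal.ofReal α0)
    (ω : ℝ) (hω : ω = tailNormSq b m) (v : ℝ)
    (hv : v = (1 / 2) * Real.exp
        (2 * Real.sqrt (2 * ω) * Real.sqrt (Q + ω)) - 1 / 2) (α : ℝ) :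
    Measure.pi (fun i => gaussianReal (m i) 1)
      {w | (π {θ | S w ≤ S (act w θ)}).toReal + v + α0 ≤ α} ≤ ENNReal.ofReal α := by
  set A := Real.sqrt (2 * ω) * Real.sqrt (Q + ω) with hA
  have hA0 : 0 ≤ A := by positivity
  have hk : 1 ≤ Real.exp (2 * A) := Real.one_le_exp (by positivity)
  have hv' : v = (Real.exp (2 * A) - 1) / 2 := by
    rw [hv, hA, ← mul_assoc]; ring
  have hv0 : 0 ≤ v := by rw [hv']; linarith
  by_cases ht : α - v - α0 < 0
  · have : {w | (π {θ | S w ≤ S (act w θ)}).toReal + v + α0 ≤ α} = ∅ := by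
      ext w
      simp only [Set.mem_ofPred_eq, Set.mem_empty_iff_false, iff_false, not_le]
      have : 0 ≤ (π {θ | S w ≤ S (act w θ)}).toReal := ENNReal.toReal_nonneg
      linarith
    rw [this]; simp
  push Not at ht
  set t := α - v - α0 with htdef
  set B : Set (Fin n → ℝ) := {w | tailNormSq b w ≤ 2 * (Q + ω)} with hBdef
  have hB : MeasurableSet B := measurableSet_le (measurable_tailNormSq b) measurable_const
  have hω0 : 0 ≤ ω := by rw [hω]; exact Finset.sum_nonneg fun i _ => sq_nonneg _
  set L : (Fin n → ℝ) → ENNReal := fun w => ENNReal.ofReal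
          (Real.exp ((∑ i, (w i - headMean b m i) ^ 2) / 2 - (∑ i, (w i - m i) ^ 2) / 2)) with hLdef
  have htilt := pi_gauss_tilt m (headMean b m)
  have hbd : ∀ w ∈ B, |∑ i ∈ Finset.univ.filter (fun i : Fin n => n - b ≤ (i : ℕ)), w i * m i| ≤ A := by
    intro w hw
    refine (tail_cs b w m).trans ?_
    rw [← hω]
    calc _ ≤ Real.sqrt (2 * (Q + ω)) * Real.sqrt ω := by
          gcongr; exact hw
      _ = A := by
          rw [hA, Real.sqrt_mul (by norm_num), Real.sqrt_mul (by norm_num)]; ring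
  have hcore := core (Measure.pi fun i => gaussianReal (headMean b m i) 1) π act hact hinv hfix S hS L
    (by fun_prop) B hB
    (fun w => by
      filter_upwards [hnorm w] with θ hθ
      simp only [hBdef, Set.mem_ofPred_eq, hθ])
    (Real.exp (2 * A)) (Real.exp (-A - ω / 2)) (Real.exp_nonneg _) hk
    (fun w hw => by
      refine ENNReal.ofReal_le_ofReal (Real.exp_le_exp.2 ?_)
      rw [tilt_exponent, ← hω]
      have := (abs_le.1 (hbd w hw)).1
      linarith)
    (fun w hw => by
      rw [← Real.exp_add]
      refine ENNReal.ofReal_le_ofReal (Real.exp_le_exp.2 ?_)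
      rw [tilt_exponent, ← hω]
      have := (abs_le.1 (hbd w hw)).2
      linarith)
    (by
      have := congrArg (fun μ => μ Set.univ) htilt
      simp only [measure_univ, withDensity_apply _ MeasurableSet.univ, Measure.restrict_univ] at this
      exact this.symm.le)
    t ht
  rw [← htilt, ← hv'] at hcore
  have hBc : Measure.pi (fun i => gaussianReal (m i) 1) Bᶜ ≤ ENNReal.ofReal α0 := by
    have hmap : Measure.pi (fun i => gaussianReal (m i) 1) =
        (stdGaussianPi n).map (fun g i => m i + g i) := by
      rw [stdGaussianPi, Measure.pi_map_pi (f := fun i x => m i + x) (by fun_prop)]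
      simp [gaussianReal_map_const_add]
    rw [hmap, Measure.map_apply (by fun_prop) hB.compl]
    refine (measure_mono ?_).trans hQ
    intro g hg
    simp only [hBdef, Set.mem_preimage, Set.mem_compl_iff, Set.mem_ofPred_eq, not_le] at hg ⊢
    have : tailNormSq b (fun i => m i + g i) ≤ 2 * (tailNormSq b g + tailNormSq b m) := by
      unfold tailNormSq
      rw [← Finset.sum_add_distrib, Finset.mul_sum]
      refine Finset.sum_le_sum fun i _ => ?_
      nlinarith [sq_nonneg (m i - g i)]
    rw [← hω] at this
    linarith
  calc _ ≤ Measure.pi (fun i => gaussianReal (m i) 1)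
        (({w | π {θ | S w ≤ S (act w θ)} ≤ ENNReal.ofReal t} ∩ B) ∪ Bᶜ) := by
        refine measure_mono fun w hw => ?_
        by_cases hwB : w ∈ B
        · left
          refine ⟨?_, hwB⟩
          simp only [Set.mem_ofPred_eq] at hw ⊢
          rw [ENNReal.le_ofReal_iff_toReal_le (measure_ne_top _ _) ht]
          linarith
        · right; exact hwB
    _ ≤ _ := measure_union_le _ _
    _ ≤ ENNReal.ofReal (t + v) + ENNReal.ofReal α0 := add_le_add hcore hBc
    _ = ENNReal.ofReal α := by
        rw [← ENNReal.ofReal_add (by linarith) hα0]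
        congr 1; rw [htdef]; ring

/-! discrete case -/

theorem permSet_mul {n b : ℕ} {ψ : Equiv.Perm (Fin n)} (h : ψ ∈ permSet n b)
    (ψ' : Equiv.Perm (Fin n)) : ψ * ψ' ∈ permSet n b ↔ ψ' ∈ permSet n b := by
  simp only [permSet, Finset.mem_filter, Finset.mem_univ, true_and] at h ⊢
  refine forall₂_congr fun i hi => ?_
  rw [Equiv.Perm.mul_apply]
  constructor
  · intro h1; exact ψ.injective (h1.trans (h i hi).symm)
  · intro h1; rw [h1, h i hi]

theorem one_mem_permSet (n b : ℕ) : (1 : Equiv.Perm (Fin n)) ∈ permSet n b := by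
  simp [permSet]

theorem permSet_symm {n b : ℕ} {ψ : Equiv.Perm (Fin n)} (h : ψ ∈ permSet n b) :
    ψ.symm ∈ permSet n b := by
  have := (permSet_mul h ψ⁻¹).1 (by simpa using one_mem_permSet n b)
  exact this

theorem permSet_lt {n b : ℕ} {ψ : Equiv.Perm (Fin n)} (h : ψ ∈ permSet n b) (i : Fin n) :
    ((ψ i : Fin n) : ℕ) < n - b ↔ (i : ℕ) < n - b := by
  have hs := permSet_symm h
  simp only [permSet, Finset.mem_filter, Finset.mem_univ, true_and] at h hs
  constructor
  · intro h1
    have := hs _ h1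
    rw [Equiv.symm_apply_apply] at this
    rwa [← this] at h1
  · intro h1; rwa [h i h1]

theorem headMean_perm {n b : ℕ} {ψ : Equiv.Perm (Fin n)} (h : ψ ∈ permSet n b) (m : Fin n → ℝ)
    (i : Fin n) : headMean b m (ψ i) = headMean b m i := by
  unfold headMean
  simp only [permSet_lt h]
  split_ifs with h1
  · simp only [permSet, Finset.mem_filter, Finset.mem_univ, true_and] at h
    rw [h i h1]
  · rfl

theorem tailNormSq_perm {n b : ℕ} {ψ : Equiv.Perm (Fin n)} (h : ψ ∈ permSet n b) (w : Fin n → ℝ) :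
    tailNormSq b (w ∘ ψ) = tailNormSq b w := by
  unfold tailNormSq
  refine Finset.sum_equiv ψ (fun i => ?_) (fun i _ => rfl)
  have := permSet_lt h i
  simp only [Finset.mem_filter, Finset.mem_univ, true_and]
  omega

theorem perm_mp {n b : ℕ} {ψ : Equiv.Perm (Fin n)} (h : ψ ∈ permSet n b) (m : Fin n → ℝ) :
    MeasurePreserving (fun w : Fin n → ℝ => w ∘ ψ)
      (Measure.pi fun i => gaussianReal (headMean b m i) 1)
      (Measure.pi fun i => gaussianReal (headMean b m i) 1) := by
  have h1 := measurePreserving_piCongrLeft (fun i => gaussianReal (headMean b m i) 1) ψ.symm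
  simp only [headMean_perm (permSet_symm h)] at h1
  convert h1 using 1
  ext w i
  have := Equiv.piCongrLeft_apply_apply (P := fun _ => ℝ) (e := ψ.symm) w (ψ i)
  simp only [Equiv.symm_apply_apply] at this
  exact this.symm

theorem main_disc {n b : ℕ} (m : Fin n → ℝ)
    (S : (Fin n → ℝ) → ℝ) (hS : Measurable S)
    (Q α0 : ℝ) (hα0 : 0 ≤ α0) (hQ : stdGaussianPi n {g | Q < tailNormSq b g} ≤ ENNReal.ofReal α0)
    (ω : ℝ) (hω : ω = tailNormSq b m) (v : ℝ)
    (hv : v = (1 / 2) * Real.exp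
        (2 * Real.sqrt (2 * ω) * Real.sqrt (Q + ω)) - 1 / 2) (α : ℝ) :
    Measure.pi (fun i => gaussianReal (m i) 1)
      {w | ((permSet n b).card : ℝ)⁻¹ * (∑ ψ ∈ permSet n b,
        if S w ≤ S (w ∘ ψ) then (1 : ℝ) else 0) + v + α0 ≤ α} ≤ ENNReal.ofReal α := by
  let _ : MeasurableSpace (Equiv.Perm (Fin n)) := ⊤
  have hcard : ((permSet n b).card : ENNReal) ≠ 0 := by
    simpa using (Finset.card_pos.2 ⟨1, one_mem_permSet n b⟩).ne'
  have hcard' : ((permSet n b).card : ENNReal) ≠ ⊤ := ENNReal.natCast_ne_top _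
  set π : Measure (Equiv.Perm (Fin n)) :=
    ((permSet n b).card : ENNReal)⁻¹ • ∑ ψ ∈ permSet n b, Measure.dirac ψ with hπ
  have happ : ∀ s : Set (Equiv.Perm (Fin n)), π s =
      ((permSet n b).card : ENNReal)⁻¹ * ∑ ψ ∈ permSet n b, s.indicator 1 ψ := by
    intro s
    rw [hπ, Measure.smul_apply, Measure.finsetSum_apply, smul_eq_mul]
    congr 1
    refine Finset.sum_congr rfl fun ψ _ => ?_
    exact Measure.dirac_apply' _ trivial
  have _ : IsProbabilityMeasure π := ⟨by
    rw [happ]; simp [ENNReal.inv_mul_cancel hcard hcard']⟩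
  have hae : ∀ P : Equiv.Perm (Fin n) → Prop, (∀ ψ ∈ permSet n b, P ψ) → ∀ᵐ ψ ∂π, P ψ := by
    intro P hP
    rw [ae_iff, happ, Finset.sum_eq_zero, mul_zero]
    intro ψ hψ
    refine Set.indicator_of_notMem ?_ _
    simpa using hP ψ hψ
  have := main_abs (b := b) m π (fun w ψ => w ∘ ψ) (measurable_from_prod_countable_left fun ψ => by
      show Measurable fun w : Fin n → ℝ => w ∘ ψ
      unfold Function.comp
      fun_prop)
    (by
      intro F hF
      have hc : ∀ ψ : Equiv.Perm (Fin n), Measurable fun w : Fin n → ℝ => F (w ∘ ψ) := by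
        intro ψ; unfold Function.comp; fun_prop
      have h1 : ∀ w : Fin n → ℝ, ∫⁻ ψ, F (w ∘ ψ) ∂π =
          ((permSet n b).card : ENNReal)⁻¹ * ∑ ψ ∈ permSet n b, F (w ∘ ψ) := by
        intro w
        rw [hπ, lintegral_smul_measure, lintegral_finsetSum_measure, smul_eq_mul]
        congr 1
        refine Finset.sum_congr rfl fun ψ _ => ?_
        exact lintegral_dirac' ψ measurable_from_top
      simp only [h1]
      rw [lintegral_const_mul _ (Finset.measurable_fun_sum _ fun ψ _ => hc ψ),
        lintegral_finsetSum _ (fun ψ _ => hc ψ),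
        Finset.sum_congr rfl (fun ψ hψ => (perm_mp hψ m).lintegral_comp hF), Finset.sum_const,
        nsmul_eq_mul, ← mul_assoc, ENNReal.inv_mul_cancel hcard hcard', one_mul])
    (by
      intro w
      refine hae _ fun ψ hψ s _ => ?_
      rw [happ, happ]
      congr 1
      refine Finset.sum_equiv (Equiv.mulLeft ψ) (fun ψ' => ?_) (fun ψ' _ => ?_)
      · exact (permSet_mul hψ ψ').symm
      · rfl)
    (fun w => hae _ fun ψ hψ => tailNormSq_perm hψ w)
    S hS Q α0 hα0 hQ ω hω v hv α
  have heq : ∀ w : Fin n → ℝ, (π {ψ | S w ≤ S (w ∘ ψ)}).toReal =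
      ((permSet n b).card : ℝ)⁻¹ * (∑ ψ ∈ permSet n b,
        if S w ≤ S (w ∘ ψ) then (1 : ℝ) else 0) := by
    intro w
    rw [happ, ENNReal.toReal_mul, ENNReal.toReal_inv, ENNReal.toReal_natCast, ENNReal.toReal_sum]
    · congr 1
      refine Finset.sum_congr rfl fun ψ _ => ?_
      by_cases h : S w ≤ S (w ∘ ψ)
      · simp [h]
      · simp [h]
    · intro ψ _
      by_cases h : S w ≤ S (w ∘ ψ) <;> simp [h]
  simp only [heq] at this
  exact this

end PPT
namespace PPT

/-! continuous case -/

theorem ae_tail_ne {n b : ℕ} (hn : 1 ≤ n) (hb1 : 1 ≤ b) :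
    ∀ᵐ g ∂(stdGaussianPi n), 0 < tailNormSq b g := by
  set i0 : Fin n := ⟨n - 1, by omega⟩ with hi0
  have h0 : stdGaussianPi n {g | g i0 = 0} = 0 := by
    have : NullSingletonClass (gaussianReal 0 1) := nullSingletonClass_gaussianReal one_ne_zero
    exact Measure.pi_hyperplane (fun _ : Fin n => gaussianReal 0 1) i0 0
  rw [ae_iff]
  refine measure_mono_null (fun g hg => ?_) h0
  by_contra hne
  apply hg
  have hpos : 0 < g i0 ^ 2 := by
    have : g i0 ≠ 0 := hne
    positivity
  refine lt_of_lt_of_le hpos ?_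
  unfold tailNormSq
  refine Finset.single_le_sum (f := fun i => g i ^ 2) (fun i _ => sq_nonneg _) ?_
  simp only [Finset.mem_filter, Finset.mem_univ, true_and, hi0]
  omega

theorem tailNormSq_wStar {n b : ℕ} (w g : Fin n → ℝ) (hg : 0 < tailNormSq b g) :
    tailNormSq b (wStar b w g) = tailNormSq b w := by
  have hw : 0 ≤ tailNormSq b w := Finset.sum_nonneg fun i _ => sq_nonneg _
  have h1 : tailNormSq b (wStar b w g) = tailNormSq b w / tailNormSq b g * tailNormSq b g := by
    conv_lhs => unfold tailNormSq
    conv_rhs => rw [show ∀ x, x * tailNormSq b g = x * ∑ i ∈ Finset.univ.filter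
      (fun i : Fin n => n - b ≤ (i : ℕ)), g i ^ 2 from fun x => rfl]
    rw [Finset.mul_sum]
    refine Finset.sum_congr rfl fun i hi => ?_
    simp only [Finset.mem_filter, Finset.mem_univ, true_and] at hi
    have : ¬ (i : ℕ) < n - b := by omega
    simp only [wStar, this, if_false]
    rw [div_pow, mul_pow, Real.sq_sqrt hw, Real.sq_sqrt hg.le]
    ring
  rw [h1, div_mul_cancel₀ _ hg.ne']

theorem wStar_wStar {n b : ℕ} (w g g' : Fin n → ℝ) (hg : 0 < tailNormSq b g) :
    wStar b (wStar b w g) g' = wStar b w g' := by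
  ext i
  unfold wStar
  split_ifs with h
  · rfl
  · have := tailNormSq_wStar w g hg
    unfold wStar at this
    rw [this]

theorem measurable_wStar {n b : ℕ} :
    Measurable (Function.uncurry (wStar b : (Fin n → ℝ) → (Fin n → ℝ) → (Fin n → ℝ))) := by
  rw [measurable_pi_iff]
  intro i
  have := measurable_tailNormSq (n := n) b
  simp only [Function.uncurry, wStar]
  split_ifs <;> fun_prop

theorem measurable_wStar_right {n b : ℕ} (w : Fin n → ℝ) :
    Measurable fun g : Fin n → ℝ => wStar b w g := by
  rw [measurable_pi_iff]
  intro i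
  have := measurable_tailNormSq (n := n) b
  simp only [wStar]
  split_ifs <;> fun_prop

/-- gluing a tail and a head -/
def glue {n : ℕ} (P : Fin n → Prop) [DecidablePred P] (x : Subtype P → ℝ)
    (h : {i // ¬ P i} → ℝ) : Fin n → ℝ :=
  fun i => if hi : P i then x ⟨i, hi⟩ else h ⟨i, hi⟩

theorem measurable_glue {n : ℕ} (P : Fin n → Prop) [DecidablePred P] :
    Measurable fun q : (Subtype P → ℝ) × ({i // ¬ P i} → ℝ) => glue P q.1 q.2 := by
  rw [measurable_pi_iff]
  intro i
  unfold glue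
  split_ifs <;> fun_prop

theorem lintegral_glue {n : ℕ} (P : Fin n → Prop) [DecidablePred P] (μ : Fin n → ℝ)
    (hμ : ∀ i : Subtype P, μ i = 0) (G : (Fin n → ℝ) → ENNReal) (hG : Measurable G) :
    ∫⁻ w, G w ∂(Measure.pi fun i => gaussianReal (μ i) 1) =
        ∫⁻ h, ∫⁻ x, G (glue P x h) ∂(Measure.pi fun _ : Subtype P => gaussianReal 0 1)
          ∂(Measure.pi fun i : {i // ¬ P i} => gaussianReal (μ i) 1) := by
  have h1 := measurePreserving_piEquivPiSubtypeProd (fun i => gaussianReal (μ i) 1) P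
  simp only [hμ] at h1
  have h2 := h1.symm
  rw [← h2.lintegral_comp hG, lintegral_prod_symm]
  · rfl
  · exact (hG.comp (MeasurableEquiv.measurable _)).aemeasurable

theorem tailNormSq_glue {n b : ℕ} (P : Fin n → Prop) [DecidablePred P]
    (hP : ∀ i, P i ↔ n - b ≤ (i : ℕ)) (x : Subtype P → ℝ) (h : {i // ¬ P i} → ℝ) :
      tailNormSq b (glue P x h) = ∑ j, x j ^ 2 := by
  unfold tailNormSq
  rw [Finset.sum_subtype (p := P) _ (fun i => by simp [hP])]
  refine Finset.sum_congr rfl fun i _ => ?_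
  rw [glue, dif_pos i.2]

theorem wStar_glue {n b : ℕ} (P : Fin n → Prop) [DecidablePred P]
    (hP : ∀ i, P i ↔ n - b ≤ (i : ℕ)) (x y : Subtype P → ℝ) (h h' : {i // ¬ P i} → ℝ) :
      wStar b (glue P x h) (glue P y h') =
        glue P (fun i => Real.sqrt (∑ j, x j ^ 2) * y i / Real.sqrt (∑ j, y j ^ 2)) h := by
  ext i
  unfold wStar
  rw [tailNormSq_glue P hP, tailNormSq_glue P hP]
  by_cases hi : P i
  · have : ¬ (i : ℕ) < n - b := by
      have := (hP i).1 hi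
      omega
    simp [glue, hi, this]
  · have : (i : ℕ) < n - b := by
      have : ¬ n - b ≤ (i : ℕ) := fun h => hi ((hP i).2 h)
      omega
    simp [glue, hi, this]

theorem inner_glue {n b : ℕ} (P : Fin n → Prop) [DecidablePred P]
    (hP : ∀ i, P i ↔ n - b ≤ (i : ℕ)) (F : (Fin n → ℝ) → ENNReal) (hF : Measurable F)
    (x : Subtype P → ℝ) (h : {i // ¬ P i} → ℝ) :
    ∫⁻ g, F (wStar b (glue P x h) g) ∂(stdGaussianPi n) =
    ∫⁻ y, F (glue P (fun i => Real.sqrt (∑ j, x j ^ 2) * y i / Real.sqrt (∑ j, y j ^ 2)) h)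
      ∂(Measure.pi fun _ : Subtype P => gaussianReal 0 1) := by
  have hjm : Measurable fun g : Fin n → ℝ => F (wStar b (glue P x h) g) :=
    hF.comp (measurable_wStar_right _)
  have h1 := lintegral_glue P (fun _ => 0) (fun _ => rfl) _ hjm
  have h2 : stdGaussianPi n = Measure.pi fun _ => gaussianReal 0 1 := rfl
  rw [h2, h1]
  simp only [wStar_glue P hP, lintegral_const, measure_univ, mul_one]

theorem wStar_inv_aux {n b : ℕ} (P : Fin n → Prop) [DecidablePred P] [Nonempty (Subtype P)]
    (hP : ∀ i, P i ↔ n - b ≤ (i : ℕ)) (m : Fin n → ℝ)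
    (F : (Fin n → ℝ) → ENNReal) (hF : Measurable F) :
      ∫⁻ w, F w ∂(Measure.pi fun i => gaussianReal (headMean b m i) 1) =
      ∫⁻ w, ∫⁻ g, F (wStar b w g) ∂(stdGaussianPi n)
        ∂(Measure.pi fun i => gaussianReal (headMean b m i) 1) := by
  have : IsProbabilityMeasure (stdGaussianPi n) := by unfold stdGaussianPi; infer_instance
  have hz : ∀ i : Subtype P, headMean b m i = 0 := by
    intro i
    have h := (hP i).1 i.2
    have : ¬ ((i : Fin n) : ℕ) < n - b := by omega
    simp [headMean, this]
  have hjm : Measurable fun q : (Fin n → ℝ) × (Fin n → ℝ) => F (wStar b q.1 q.2) :=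
    hF.comp measurable_wStar
  rw [lintegral_glue P _ hz F hF, lintegral_glue P _ hz _ hjm.lintegral_prod_right']
  refine lintegral_congr fun h => ?_
  calc _ = ∫⁻ x, F (glue P x h) ∂(Measure.pi fun _ : Subtype P => gaussianReal 0 1) := rfl
    _ = _ := (gauss_resample (fun x => F (glue P x h))
      (hF.comp ((measurable_glue P).comp (measurable_id.prodMk measurable_const)))).symm
    _ = _ := lintegral_congr fun x => (inner_glue P hP F hF x h).symm

theorem wStar_inv {n b : ℕ} (hn : 1 ≤ n) (hb1 : 1 ≤ b) (m : Fin n → ℝ)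
    (F : (Fin n → ℝ) → ENNReal) (hF : Measurable F) :
      ∫⁻ w, F w ∂(Measure.pi fun i => gaussianReal (headMean b m i) 1) =
      ∫⁻ w, ∫⁻ g, F (wStar b w g) ∂(stdGaussianPi n)
        ∂(Measure.pi fun i => gaussianReal (headMean b m i) 1) := by
  have : Nonempty (Subtype fun i : Fin n => n - b ≤ (i : ℕ)) :=
    ⟨⟨⟨n - 1, by omega⟩, by show n - b ≤ n - 1; omega⟩⟩
  exact wStar_inv_aux (fun i : Fin n => n - b ≤ (i : ℕ)) (fun _ => Iff.rfl) m F hF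

theorem main_cont {n b : ℕ} (hn : 1 ≤ n) (hb1 : 1 ≤ b) (m : Fin n → ℝ)
    (S : (Fin n → ℝ) → ℝ) (hS : Measurable S)
    (Q α0 : ℝ) (hα0 : 0 ≤ α0) (hQ : stdGaussianPi n {g | Q < tailNormSq b g} ≤ ENNReal.ofReal α0)
    (ω : ℝ) (hω : ω = tailNormSq b m) (v : ℝ)
    (hv : v = (1 / 2) * Real.exp
        (2 * Real.sqrt (2 * ω) * Real.sqrt (Q + ω)) - 1 / 2) (α : ℝ) :
    Measure.pi (fun i => gaussianReal (m i) 1)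
      {w | (stdGaussianPi n {g | S w ≤ S (wStar b w g)}).toReal + v + α0 ≤ α}
        ≤ ENNReal.ofReal α := by
  have : IsProbabilityMeasure (stdGaussianPi n) := by unfold stdGaussianPi; infer_instance
  refine main_abs (b := b) m (stdGaussianPi n) (wStar b) measurable_wStar
    (wStar_inv hn hb1 m) (fun w => ?_) (fun w => ?_) S hS Q α0 hα0 hQ ω hω v hv α
  · filter_upwards [ae_tail_ne hn hb1] with g hg s _
    simp only [wStar_wStar w g _ hg]
  · filter_upwards [ae_tail_ne hn hb1] with g hg using tailNormSq_wStar w g hg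

/-! chi-squared quantile -/

theorem quantile_bound (k : ℕ) (α0 : ℝ) (h0 : 0 < α0) (h1 : α0 < 1) :
    ENNReal.ofReal (1 - α0) ≤ chiSq k (Set.Iic (chiSqQuantile k (1 - α0))) := by
  have hm : Measurable (fun g : Fin k → ℝ => ∑ i, g i ^ 2) := by fun_prop
  have : IsProbabilityMeasure (stdGaussianPi k) := by unfold stdGaussianPi; infer_instance
  have : IsProbabilityMeasure (chiSq k) := Measure.isProbabilityMeasure_map hm.aemeasurable
  set U := {x : ℝ | ENNReal.ofReal (1 - α0) ≤ chiSq k (Set.Iic x)} with hU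
  have hne : U.Nonempty := by
    have ht := tendsto_measure_Iic_atTop (chiSq k)
    rw [measure_univ] at ht
    have hlt : ENNReal.ofReal (1 - α0) < 1 := by
      rw [ENNReal.ofReal_lt_one]; linarith
    obtain ⟨x, hx⟩ := (ht.eventually (lt_mem_nhds hlt)).exists
    exact ⟨x, hx.le⟩
  have hbdd : BddBelow U := by
    refine ⟨0, fun x hx => ?_⟩
    by_contra hneg
    push Not at hneg
    have : chiSq k (Set.Iic x) = 0 := by
      rw [chiSq, Measure.map_apply hm measurableSet_Iic]
      have : (fun g : Fin k → ℝ => ∑ i, g i ^ 2) ⁻¹' Set.Iic x = ∅ := by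
        ext g
        simp only [Set.mem_preimage, Set.mem_Iic, Set.mem_empty_iff_false, iff_false, not_le]
        exact hneg.trans_le (Finset.sum_nonneg fun i _ => sq_nonneg _)
      rw [this, measure_empty]
    rw [hU, Set.mem_ofPred_eq, this] at hx
    have : ENNReal.ofReal (1 - α0) > 0 := ENNReal.ofReal_pos.2 (by linarith)
    exact absurd hx (not_le.2 this)
  have hQ : chiSqQuantile k (1 - α0) = sInf U := rfl
  rw [hQ]
  set Q := sInf U
  have hmem : ∀ j : ℕ, Q + 1 / ((j : ℝ) + 1) ∈ U := by
    intro j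
    have : Q < Q + 1 / ((j : ℝ) + 1) := by
      have : (0 : ℝ) < 1 / ((j : ℝ) + 1) := by positivity
      linarith
    obtain ⟨x, hx, hlt⟩ := (csInf_lt_iff hbdd hne).1 this
    exact le_trans (show ENNReal.ofReal (1 - α0) ≤ chiSq k (Set.Iic x) from hx)
      (measure_mono (Set.Iic_subset_Iic.2 hlt.le))
  have hinter : Set.Iic Q = ⋂ j : ℕ, Set.Iic (Q + 1 / ((j : ℝ) + 1)) := by
    ext x
    simp only [Set.mem_Iic, Set.mem_iInter]
    constructor
    · intro h j
      have : (0 : ℝ) < 1 / ((j : ℝ) + 1) := by positivity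
      linarith
    · intro h
      refine le_of_forall_pos_le_add fun ε hε => ?_
      obtain ⟨j, hj⟩ := exists_nat_one_div_lt hε
      have := h j
      linarith
  have hanti : Antitone fun j : ℕ => Set.Iic (Q + 1 / ((j : ℝ) + 1)) := by
    intro i j hij
    apply Set.Iic_subset_Iic.2
    have := Nat.one_div_le_one_div (α := ℝ) hij
    linarith
  rw [hinter, hanti.measure_iInter (fun j => measurableSet_Iic.nullMeasurableSet)
    ⟨0, measure_ne_top _ _⟩]
  exact le_iInf hmem

theorem tail_law {n b : ℕ} (hb2 : b ≤ n) :
    (stdGaussianPi n).map (tailNormSq b) = chiSq b := by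
  let f : Fin b → Fin n := fun j => ⟨n - b + j, by omega⟩
  have hmp : (stdGaussianPi n).map (fun g j => g (f j)) = stdGaussianPi b := by
    have hinj : Function.Injective f := by
      intro i j hij
      simpa [f, Fin.ext_iff] using hij
    have hind := (iIndepFun_pi (μ := fun _ : Fin n => gaussianReal 0 1)
      (X := fun _ x => x) (fun _ => aemeasurable_id)).precomp hinj
    have h2 := (iIndepFun_iff_map_fun_eq_pi_map (fun j => (measurable_pi_apply (f j)).aemeasurable)).1 hind
    have h3 : ∀ i : Fin n, (Measure.pi fun _ : Fin n => gaussianReal 0 1).map (fun g => g i) =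
        gaussianReal 0 1 := fun i =>
      (measurePreserving_eval (fun _ : Fin n => gaussianReal 0 1) i).map_eq
    unfold stdGaussianPi
    simp only [h3] at h2
    exact h2
  rw [chiSq, ← hmp, Measure.map_map (by fun_prop) (by fun_prop)]
  congr 1
  ext g
  simp only [Function.comp, tailNormSq]
  symm
  refine Finset.sum_bij (fun j _ => f j) (fun j _ => ?_) (fun i _ j _ hij => ?_) (fun i hi => ?_)
    (fun j _ => rfl)
  · simp [f]; omega
  · simpa [f, Fin.ext_iff] using hij
  · simp only [Finset.mem_filter, Finset.mem_univ, true_and] at hi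
    exact ⟨⟨i - (n - b), by omega⟩, Finset.mem_univ _, by ext; simp [f]; omega⟩

theorem tail_bound {n b : ℕ} (hb2 : b ≤ n) (α0 : ℝ) (h0 : 0 < α0) (h1 : α0 < 1) :
    stdGaussianPi n {g | chiSqQuantile b (1 - α0) < tailNormSq b g} ≤ ENNReal.ofReal α0 := by
  have hm : Measurable (fun g : Fin b → ℝ => ∑ i, g i ^ 2) := by fun_prop
  have : IsProbabilityMeasure (stdGaussianPi b) := by unfold stdGaussianPi; infer_instance
  have : IsProbabilityMeasure (chiSq b) := Measure.isProbabilityMeasure_map hm.aemeasurable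
  have hq := quantile_bound b α0 h0 h1
  set Q := chiSqQuantile b (1 - α0)
  have e1 : stdGaussianPi n {g | Q < tailNormSq b g} = chiSq b (Set.Iic Q)ᶜ := by
    rw [← tail_law hb2, Measure.map_apply (measurable_tailNormSq b) measurableSet_Iic.compl]
    congr 1
    ext g
    simp
  rw [e1, prob_compl_eq_one_sub measurableSet_Iic]
  calc _ ≤ 1 - ENNReal.ofReal (1 - α0) := tsub_le_tsub_left hq _
    _ = ENNReal.ofReal α0 := by
      rw [← ENNReal.ofReal_one, ← ENNReal.ofReal_sub _ (by linarith)]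
      congr 1; ring

/-! rotation and reduction -/

theorem rot_law {n : ℕ} (Γ : Fin n → Fin n → ℝ) (hΓ : IsOrthogonalF Γ) :
    (stdGaussianPi n).map (tmulVecF Γ) = stdGaussianPi n := by
  let lin : EuclideanSpace ℝ (Fin n) →ₗ[ℝ] EuclideanSpace ℝ (Fin n) :=
    Matrix.toEuclideanLin (Matrix.of fun i j => Γ j i)
  have hlin : ∀ x i, lin x i = tmulVecF Γ (fun j => x j) i := by
    intro x i
    simp [lin, Matrix.toLpLin_apply, Matrix.mulVec, dotProduct, tmulVecF]
  have hnorm : ∀ x, ‖lin x‖ = ‖x‖ := by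
    intro x
    rw [EuclideanSpace.norm_eq, EuclideanSpace.norm_eq]
    congr 1
    simp only [Real.norm_eq_abs, sq_abs, hlin, tmulVecF]
    calc ∑ i, (∑ j, Γ j i * x j) ^ 2
        = ∑ i, ∑ j, ∑ k, x j * x k * (Γ j i * Γ k i) := by
          refine Finset.sum_congr rfl fun i _ => ?_
          rw [sq, Finset.sum_mul_sum]
          refine Finset.sum_congr rfl fun j _ => Finset.sum_congr rfl fun k _ => ?_
          ring
      _ = ∑ j, ∑ k, x j * x k * ∑ i, Γ j i * Γ k i := by
          rw [Finset.sum_comm]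
          refine Finset.sum_congr rfl fun j _ => ?_
          rw [Finset.sum_comm]
          refine Finset.sum_congr rfl fun k _ => ?_
          rw [Finset.mul_sum]
      _ = ∑ j, x j ^ 2 := by
          refine Finset.sum_congr rfl fun j _ => ?_
          simp only [hΓ j]
          simp [sq]
  let iso : EuclideanSpace ℝ (Fin n) ≃ₗᵢ[ℝ] EuclideanSpace ℝ (Fin n) :=
    LinearIsometry.toLinearIsometryEquiv ⟨lin, hnorm⟩ rfl
  have h1 := stdGaussian_map iso
  rw [← map_pi_eq_stdGaussian] at h1
  have h2 := congrArg (fun μ => μ.map (WithLp.ofLp : EuclideanSpace ℝ (Fin n) → (Fin n → ℝ))) h1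
  have hiso : Measurable iso := iso.continuous.measurable
  have hof : Measurable (WithLp.ofLp : EuclideanSpace ℝ (Fin n) → (Fin n → ℝ)) := by fun_prop
  have hto : Measurable (WithLp.toLp 2 : (Fin n → ℝ) → EuclideanSpace ℝ (Fin n)) := by fun_prop
  simp only at h2
  rw [Measure.map_map hiso hto, Measure.map_map hof (hiso.comp hto), Measure.map_map hof hto] at h2
  have h3 : (WithLp.ofLp ∘ WithLp.toLp 2 : (Fin n → ℝ) → (Fin n → ℝ)) = id := by ext; rfl
  rw [h3, Measure.map_id] at h2
  have h4 : WithLp.ofLp ∘ iso ∘ WithLp.toLp 2 = tmulVecF Γ := by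
    ext g i
    exact hlin _ i
  rw [h4] at h2
  exact h2

theorem noise_law (n : ℕ) (σ : ℝ) :
    noiseLaw n σ = (stdGaussianPi n).map (fun g i => σ * g i) := by
  rw [stdGaussianPi, Measure.pi_map_pi (f := fun _ x => σ * x) (by fun_prop)]
  unfold noiseLaw
  congr 1
  ext1 i
  rw [gaussianReal_map_const_mul]
  congr 1
  · simp
  · ext; simp [Real.coe_toNNReal _ (sq_nonneg σ)]

theorem measurable_tmulVecF {n : ℕ} (Γ : Fin n → Fin n → ℝ) : Measurable (tmulVecF Γ) := by
  unfold tmulVecF; fun_prop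

/-- the law of the standardized rotated response -/
theorem W_law {n : ℕ} (Γ : Fin n → Fin n → ℝ) (hΓ : IsOrthogonalF Γ) (σ : ℝ) (hσ : 0 < σ)
    (f : Fin n → ℝ) :
    ((noiseLaw n σ).map (fun ε i => f i + ε i)).map (fun y i => σ⁻¹ * tmulVecF Γ y i) =
      Measure.pi fun i => gaussianReal (σ⁻¹ * tmulVecF Γ f i) 1 := by
  have hmt := measurable_tmulVecF Γ
  have hW : Measurable fun (y : Fin n → ℝ) i => σ⁻¹ * tmulVecF Γ y i := by fun_prop
  rw [noise_law, Measure.map_map hW (by fun_prop), Measure.map_map (hW.comp (by fun_prop)) (by fun_prop), Function.comp_assoc]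
  have : ((fun (y : Fin n → ℝ) i => σ⁻¹ * tmulVecF Γ y i) ∘ (fun (ε : Fin n → ℝ) i => f i + ε i) ∘
      fun (g : Fin n → ℝ) i => σ * g i) =
      (fun (g : Fin n → ℝ) i => σ⁻¹ * tmulVecF Γ f i + g i) ∘ tmulVecF Γ := by
    ext g i
    simp only [Function.comp, tmulVecF]
    rw [Finset.mul_sum, Finset.mul_sum, ← Finset.sum_add_distrib]
    refine Finset.sum_congr rfl fun j _ => ?_
    field_simp
  rw [this, ← Measure.map_map (by fun_prop) hmt, rot_law Γ hΓ, stdGaussianPi,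
    Measure.pi_map_pi (f := fun i x => σ⁻¹ * tmulVecF Γ f i + x) (by fun_prop)]
  simp [gaussianReal_map_const_add]

theorem mul_tmul {n : ℕ} (Γ : Fin n → Fin n → ℝ) (hΓ : IsOrthogonalF Γ) (y : Fin n → ℝ) :
    mulVecF Γ (tmulVecF Γ y) = y := by
  ext i
  simp only [mulVecF, tmulVecF]
  calc _ = ∑ j, ∑ k, (Γ i k * Γ j k) * y j := by
        rw [Finset.sum_comm]
        refine Finset.sum_congr rfl fun k _ => ?_
        rw [Finset.mul_sum]
        refine Finset.sum_congr rfl fun j _ => ?_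
        ring
    _ = ∑ j, (∑ k, Γ i k * Γ j k) * y j := by simp only [Finset.sum_mul]
    _ = y i := by simp only [hΓ i]; simp

theorem wStar_scale {n b : ℕ} (σ : ℝ) (hσ : 0 < σ) (w g : Fin n → ℝ) :
    (fun i => σ * wStar b (fun i => σ⁻¹ * w i) g i) = wStar b w g := by
  have h1 : tailNormSq b (fun i => σ⁻¹ * w i) = (σ⁻¹) ^ 2 * tailNormSq b w := by
    unfold tailNormSq
    rw [Finset.mul_sum]
    refine Finset.sum_congr rfl fun i _ => ?_
    ring
  ext i
  unfold wStar
  rw [h1, Real.sqrt_mul (sq_nonneg _), Real.sqrt_sq (by positivity)]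
  split_ifs
  · field_simp
  · field_simp

end PPT
open PPT in
/-- Theorem 3: validity of the corrected partial permutation p-value
`p_c = p + v(b, σ₀⁻¹f₀, α₀) + α₀` for a general kernel and a general (measurable) regression
function, where `v` is built from the left-over signal proportion `ω(b, σ₀⁻¹f₀)` and the
chi-squared quantile `Q_b(1-α₀)`. -/
theorem partial_permutation_valid_corrected
    {n d H : ℕ} (hn : 1 ≤ n)
    (X : Fin n → Fin d → ℝ) (Z : Fin n → Fin H)
    -- the true functional relationship, an arbitrary measurable function
    (f0 : (Fin d → ℝ) → ℝ) (hf0 : Measurable f0)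
    -- noise level
    (σ0 : ℝ) (hσ0 : 0 < σ0)
    -- the law of Y = f0(X) + ε with ε ~ N(0, σ0² Iₙ)
    (μY : Measure (Fin n → ℝ))
    (hμY : μY = Measure.map (fun ε : Fin n → ℝ => fun i => f0 (X i) + ε i) (noiseLaw n σ0))
    -- a symmetric positive semidefinite kernel and its sample kernel matrix
    (K : (Fin d → ℝ) → (Fin d → ℝ) → ℝ) (hK : IsPSDKernel K)
    (Kn : Fin n → Fin n → ℝ) (hKn : ∀ i j, Kn i j = K (X i) (X j))
    -- a fixed eigendecomposition Kn = Γ diag(c) Γᵀ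
    (Γ : Fin n → Fin n → ℝ) (c : Fin n → ℝ) (hEig : IsEigenDecomp Kn Γ c)
    -- permutation size
    (b : ℕ) (hb1 : 1 ≤ b) (hb2 : b ≤ n)
    -- arbitrary (measurable) test statistic
    (T : (Fin n → Fin d → ℝ) → (Fin n → ℝ) → (Fin n → Fin H) → ℝ)
    (hT : Measurable fun y => T X y Z)
    -- correction level α₀
    (α0 : ℝ) (hα0 : α0 ∈ Set.Ioo (0 : ℝ) 1)
    -- left-over signal proportion ω(b, σ₀⁻¹ f₀)
    (ω : ℝ)
    (hω : ω = (σ0 ^ 2)⁻¹ *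
      ∑ i ∈ Finset.univ.filter (fun i : Fin n => n - b ≤ (i : ℕ)),
        (tmulVecF Γ (fun j => f0 (X j)) i) ^ 2)
    -- correction term v(b, σ₀⁻¹ f₀, α₀)
    (v : ℝ)
    (hv : v = (1 / 2) * Real.exp
        (2 * Real.sqrt (2 * ω) * Real.sqrt (chiSqQuantile b (1 - α0) + ω)) - 1 / 2) :
    ∀ α ∈ Set.Ioo (0 : ℝ) 1,
      μY {y | pDisc X Z T Γ b y + v + α0 ≤ α} ≤ ENNReal.ofReal α ∧
      μY {y | pCont X Z T Γ b y + v + α0 ≤ α} ≤ ENNReal.ofReal α := by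
  intro α _
  have hΓ : IsOrthogonalF Γ := hEig.1
  have hσ : σ0 ≠ 0 := hσ0.ne'
  set m : Fin n → ℝ := fun i => σ0⁻¹ * tmulVecF Γ (fun j => f0 (X j)) i with hm
  set S : (Fin n → ℝ) → ℝ := fun w => T X (mulVecF Γ (fun i => σ0 * w i)) Z with hSdef
  have hS : Measurable S := by
    refine hT.comp ?_
    unfold mulVecF
    fun_prop
  have hωm : ω = tailNormSq b m := by
    rw [hω, tailNormSq, Finset.mul_sum]
    refine Finset.sum_congr rfl fun i _ => ?_
    rw [hm, mul_pow, inv_pow]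
  have hQ := tail_bound (n := n) hb2 α0 hα0.1 hα0.2
  have hW : Measurable fun (y : Fin n → ℝ) i => σ0⁻¹ * tmulVecF Γ y i := by
    have := measurable_tmulVecF Γ
    fun_prop
  have hlaw : μY.map (fun y i => σ0⁻¹ * tmulVecF Γ y i) =
      Measure.pi fun i => gaussianReal (m i) 1 := by
    rw [hμY]
    exact W_law Γ hΓ σ0 hσ0 (fun j => f0 (X j))
  have hcancel : ∀ w : Fin n → ℝ, (fun i => σ0 * (σ0⁻¹ * w i)) = w := by
    intro w; ext i; rw [mul_inv_cancel_left₀ hσ]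
  have hSy : ∀ y, S (fun i => σ0⁻¹ * tmulVecF Γ y i) = T X y Z := by
    intro y
    simp only [hSdef, hcancel, mul_tmul Γ hΓ]
  constructor
  · have h1 := main_disc m S hS _ α0 hα0.1.le hQ ω hωm v hv α
    rw [← hlaw] at h1
    refine le_trans ?_ ((Measure.le_map_apply hW.aemeasurable _).trans h1)
    refine measure_mono fun y hy => ?_
    simp only [Set.mem_preimage, Set.mem_ofPred_eq, hSy] at hy ⊢
    convert hy using 3
    unfold pDisc
    congr 1
    refine Finset.sum_congr rfl fun ψ _ => ?_
    have : S ((fun i => σ0⁻¹ * tmulVecF Γ y i) ∘ ψ) = T X (mulVecF Γ ((tmulVecF Γ y) ∘ ψ)) Z := by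
      simp only [hSdef, Function.comp_def]
      congr 2
      exact hcancel _
    rw [this]
  · have h1 := main_cont hn hb1 m S hS _ α0 hα0.1.le hQ ω hωm v hv α
    rw [← hlaw] at h1
    refine le_trans ?_ ((Measure.le_map_apply hW.aemeasurable _).trans h1)
    refine measure_mono fun y hy => ?_
    simp only [Set.mem_preimage, Set.mem_ofPred_eq, hSy] at hy ⊢
    convert hy using 3
    unfold pCont
    simp only [hSdef, wStar_scale σ0 hσ0]
end
end

section
/- Fix n ≥ 1, a covariate matrix X ∈ ℝ^{n×d}, group labels Z ∈ {1,…,H}ⁿ, a measurable function f₀ : ℝᵈ → ℝ, and σ₀ > 0, and suppose Y = f₀(X) + ε with ε ~ N(0, σ₀² I_n). Suppose the design is exactly balanced: the multiset {X_i : Z_i = h} is the same for every group h = 1,…,H; let r ≤ n/H be the number of distinct covariate values, and assume the r×r kernel matrix of the r distinct covariate values is nonsingular (equivalently, rank(K_n) = r). Then for any permutation size b with 1 ≤ b ≤ n − r and any test statistic T, both the discrete and the continuous partial permutation p-values are valid: Pr(p(X,Y,Z) ≤ α) ≤ α for every α ∈ (0,1). -/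
open MeasureTheory ProbabilityTheory Filter

noncomputable section

theorem aux_superuniform {G : Type*} [MeasurableSpace G] (q : Measure G) [IsProbabilityMeasure q]
    (U : G → ℝ) (hU : Measurable U) (a : ENNReal) :
    q {g | q {g' | U g ≤ U g'} ≤ a} ≤ a := by
  set ρ := q.map U with hρ
  have : IsProbabilityMeasure ρ := Measure.isProbabilityMeasure_map hU.aemeasurable
  set D : Set ℝ := {s | ρ (Set.Ici s) ≤ a} with hD
  have hup : IsUpperSet D := by
    intro s t hst hs
    exact (measure_mono (Set.Ici_subset_Ici.2 hst)).trans hs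
  have hDm : MeasurableSet D := hup.ordConnected.measurableSet
  have h1 : {g | q {g' | U g ≤ U g'} ≤ a} = U ⁻¹' D := by
    ext g
    simp only [Set.mem_ofPred_eq, hD, Set.mem_preimage]
    rw [hρ, Measure.map_apply hU measurableSet_Ici]
    rfl
  rw [h1, ← Measure.map_apply hU hDm, ← hρ, hDm.measure_eq_iSup_isCompact]
  refine iSup_le fun K => iSup_le fun hKD => iSup_le fun hK => ?_
  rcases K.eq_empty_or_nonempty with rfl | hne
  · simp
  obtain ⟨m, hm, hmin⟩ := hK.exists_isLeast hne
  exact (measure_mono (fun x hx => hmin hx)).trans (hKD hm)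

theorem aux_valid {Ω G : Type*} [MeasurableSpace Ω] [MeasurableSpace G]
    (ν : Measure Ω) [IsProbabilityMeasure ν] (q : Measure G) [IsProbabilityMeasure q]
    (A : Ω → G → Ω) (hA : Measurable (Function.uncurry A))
    (hinv : (ν.prod q).map (Function.uncurry A) = ν)
    (S : Ω → ℝ) (hS : Measurable S)
    (h2 : ∀ w, ∀ᵐ g ∂q, ∀ s : ℝ, q {g' | s ≤ S (A (A w g) g')} = q {g' | s ≤ S (A w g')})
    (α : ℝ) :
    ν {w | (q {g | S w ≤ S (A w g)}).toReal ≤ α} ≤ ENNReal.ofReal α := by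
  by_cases hα : α < 0
  · have : {w | (q {g | S w ≤ S (A w g)}).toReal ≤ α} = ∅ := by
      ext w
      simp only [Set.mem_ofPred_eq, Set.mem_empty_iff_false, iff_false, not_le]
      exact hα.trans_le ENNReal.toReal_nonneg
    simp [this]
  push Not at hα
  set B : Set Ω := {w | q {g | S w ≤ S (A w g)} ≤ ENNReal.ofReal α} with hB
  have hBe : {w | (q {g | S w ≤ S (A w g)}).toReal ≤ α} = B := by
    ext w
    simp only [hB, Set.mem_ofPred_eq]
    rw [ENNReal.le_ofReal_iff_toReal_le (measure_ne_top _ _) hα]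
  have hm : MeasurableSet {p : Ω × G | S p.1 ≤ S (A p.1 p.2)} :=
    measurableSet_le (hS.comp measurable_fst) (hS.comp hA)
  have hBm : MeasurableSet B :=
    measurableSet_le (measurable_measure_prodMk_left (ν := q) hm) measurable_const
  rw [hBe]
  conv_lhs => rw [← hinv]
  rw [Measure.map_apply hA hBm, Measure.prod_apply (hA hBm)]
  calc _ ≤ ∫⁻ w, ENNReal.ofReal α ∂ν := by
        refine lintegral_mono fun w => ?_
        have hAw : Measurable (A w) := hA.comp measurable_prodMk_left
        refine le_trans (le_of_eq ?_) (aux_superuniform q (fun g => S (A w g)) (hS.comp hAw) _)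
        refine measure_congr ?_
        filter_upwards [h2 w] with g hg
        refine propext ?_
        change q {g' | S (A w g) ≤ S (A (A w g) g')} ≤ _ ↔ q {g' | S (A w g) ≤ S (A w g')} ≤ _
        rw [hg]
    _ = _ := by simp

theorem aux_pi_density {ι : Type*} [Fintype ι] (v : NNReal) (hv : v ≠ 0) :
    Measure.pi (fun _ : ι => gaussianReal 0 v) =
      (volume : Measure (ι → ℝ)).withDensity
        (fun x => ENNReal.ofReal (((Real.sqrt (2 * Real.pi * v))⁻¹) ^ (Fintype.card ι) *
          Real.exp (-(∑ i, x i ^ 2) / (2 * v)))) := by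
  have h0 : (fun x : ι → ℝ => ENNReal.ofReal (((Real.sqrt (2 * Real.pi * v))⁻¹) ^ (Fintype.card ι) *
          Real.exp (-(∑ i, x i ^ 2) / (2 * v)))) =
        fun x => ENNReal.ofReal (∏ i, gaussianPDFReal 0 v (x i)) := by
    funext x
    simp only [gaussianPDFReal, Finset.prod_mul_distrib, Finset.prod_const, Finset.card_univ,
      ← Real.exp_sum, sub_zero, ← Finset.sum_div, Finset.sum_neg_distrib]
  rw [h0]
  refine Measure.pi_eq fun s hs => ?_
  rw [withDensity_apply _ (MeasurableSet.univ_pi hs), volume_pi, Measure.restrict_pi_pi,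
    ← ofReal_integral_eq_lintegral_ofReal, integral_fintype_prod_eq_prod,
    ENNReal.ofReal_prod_of_nonneg]
  · refine Finset.prod_congr rfl fun i _ => ?_
    rw [gaussianReal_apply_eq_integral _ hv]
  · intro i _
    exact integral_nonneg fun x => gaussianPDFReal_nonneg _ _ _
  · exact Integrable.fintype_prod fun i => (integrable_gaussianPDFReal 0 v).restrict
  · exact Eventually.of_forall fun x => Finset.prod_nonneg fun i _ => gaussianPDFReal_nonneg _ _ _

theorem aux_rot {n : ℕ} (M : Matrix (Fin n) (Fin n) ℝ) (hM : M.transpose * M = 1)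
    (v : NNReal) (hv : v ≠ 0) :
    (Measure.pi (fun _ : Fin n => gaussianReal 0 v)).map (fun x => M.mulVec x) =
      Measure.pi (fun _ : Fin n => gaussianReal 0 v) := by
  have hdet : M.det * M.det = 1 := by
    have := congrArg Matrix.det hM
    simpa [Matrix.det_mul, Matrix.det_transpose] using this
  have habs : |M.det⁻¹| = 1 := by
    rcases mul_self_eq_one_iff.1 hdet with h | h <;> simp [h]
  have hne : M.det ≠ 0 := by
    intro h; simp [h] at hdet
  have hvol : MeasurePreserving (fun x => M.mulVec x) (volume : Measure (Fin n → ℝ)) volume := by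
    refine ⟨by fun_prop, ?_⟩
    have := Real.map_matrix_volume_pi_eq_smul_volume_pi hne
    rw [habs] at this
    rw [ENNReal.ofReal_one, one_smul] at this
    exact this
  have hnorm : ∀ x : Fin n → ℝ, ∑ i, (M.mulVec x) i ^ 2 = ∑ i, x i ^ 2 := by
    intro x
    have h1 : (M.mulVec x) ⬝ᵥ (M.mulVec x) = x ⬝ᵥ x := by
      rw [Matrix.dotProduct_mulVec, ← Matrix.mulVec_transpose, Matrix.mulVec_mulVec, hM,
        Matrix.one_mulVec]
    simpa [dotProduct, pow_two] using h1
  rw [aux_pi_density v hv]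
  ext s hs
  rw [Measure.map_apply hvol.measurable hs, withDensity_apply _ (hvol.measurable hs),
    withDensity_apply _ hs, ← hvol.setLIntegral_comp_preimage hs (by fun_prop)]
  simp only [hnorm]

theorem aux_polar {E : Type*} [NormedAddCommGroup E] [NormedSpace ℝ E] [MeasurableSpace E]
    [Nontrivial E] [FiniteDimensional ℝ E] [BorelSpace E] (μ : Measure E) [μ.IsAddHaarMeasure]
    (F : E → ENNReal) (hF : Measurable F) :
    ∫⁻ x, F x ∂μ = ∫⁻ r : Set.Ioi (0:ℝ), ∫⁻ θ, F (r.1 • (θ : E)) ∂μ.toSphere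
        ∂(Measure.volumeIoiPow (Module.finrank ℝ E - 1)) := by
  have hmeas : Measurable (fun p : Metric.sphere (0:E) 1 × Set.Ioi (0:ℝ) => F (p.2.1 • (p.1 : E))) := by
    fun_prop
  calc ∫⁻ x, F x ∂μ = ∫⁻ x : ({(0)}ᶜ : Set E), F x.1 ∂(μ.comap (↑)) := by
        rw [lintegral_subtype_comap (measurableSet_singleton _).compl F,
          restrict_compl_singleton]
    _ = ∫⁻ p, F (p.2.1 • (p.1 : E)) ∂(μ.toSphere.prod (.volumeIoiPow (Module.finrank ℝ E - 1))) := by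
        rw [← μ.measurePreserving_homeomorphUnitSphereProd.lintegral_comp hmeas]
        refine lintegral_congr fun x => ?_
        have hx : ‖x.1‖ ≠ 0 := norm_ne_zero_iff.2 x.2
        simp [smul_smul, hx]
    _ = _ := by
        rw [lintegral_prod_symm' _ hmeas]

theorem aux_radial {E : Type*} [NormedAddCommGroup E] [NormedSpace ℝ E] [MeasurableSpace E]
    [Nontrivial E] [FiniteDimensional ℝ E] [BorelSpace E] (μ : Measure E) [μ.IsAddHaarMeasure]
    (h1 h2 : ℝ → ENNReal) (hh1 : Measurable h1) (hh2 : Measurable h2)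
    (φ : E → ENNReal) (hφ : Measurable φ) :
    ∫⁻ x, h1 ‖x‖ * ∫⁻ y, h2 ‖y‖ * φ ((‖x‖ / ‖y‖) • y) ∂μ ∂μ =
      (∫⁻ y, h2 ‖y‖ ∂μ) * ∫⁻ x, h1 ‖x‖ * φ x ∂μ := by
  set V := Measure.volumeIoiPow (Module.finrank ℝ E - 1) with hV
  set τ := μ.toSphere with hτ
  set Φ : ℝ → ENNReal := fun s => ∫⁻ θ, φ (s • (θ : E)) ∂τ with hΦ
  have hΦm : Measurable Φ := by
    have : Measurable (fun p : ℝ × Metric.sphere (0:E) 1 => φ (p.1 • (p.2 : E))) := by fun_prop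
    exact this.lintegral_prod_right'
  have hnorm : ∀ (r : Set.Ioi (0:ℝ)) (θ : Metric.sphere (0:E) 1), ‖r.1 • (θ : E)‖ = r.1 := by
    intro r θ
    have := r.2
    simp only [Set.mem_Ioi] at this
    simp [norm_smul, abs_of_pos this]
  have hinner : ∀ x : E, ∫⁻ y, h2 ‖y‖ * φ ((‖x‖ / ‖y‖) • y) ∂μ = (∫⁻ r, h2 r.1 ∂V) * Φ ‖x‖ := by
    intro x
    rw [aux_polar μ _ (by fun_prop)]
    rw [← lintegral_mul_const _ (by fun_prop)]
    refine lintegral_congr fun r => ?_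
    have hr : r.1 ≠ 0 := ne_of_gt r.2
    simp only [hnorm, smul_smul, div_mul_cancel₀ _ hr]
    rw [lintegral_const_mul _ (by fun_prop)]
  simp_rw [hinner]
  rw [aux_polar μ (fun y => h2 ‖y‖) (by fun_prop),
    aux_polar μ (fun x => h1 ‖x‖ * φ x) (by fun_prop),
    aux_polar μ (fun x => h1 ‖x‖ * (_ * Φ ‖x‖)) (by fun_prop)]
  simp only [hnorm, lintegral_const]
  rw [lintegral_mul_const _ (by fun_prop), lintegral_mul_const _ (by fun_prop)]
  have e1 : ∀ r : Set.Ioi (0:ℝ), ∫⁻ θ, h1 r.1 * φ (r.1 • (θ : E)) ∂τ = h1 r.1 * Φ r.1 := by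
    intro r
    rw [lintegral_const_mul _ (by fun_prop)]
  have e2 : ∀ r : Set.Ioi (0:ℝ), h1 r.1 * ((∫⁻ r, h2 r.1 ∂V) * Φ r.1) =
      (∫⁻ r, h2 r.1 ∂V) * (h1 r.1 * Φ r.1) := by
    intro r; ring
  rw [← hV, ← hτ]
  simp_rw [e1, e2]
  rw [lintegral_const_mul _ (by fun_prop)]
  ring

theorem aux_sphere {ι : Type*} [Fintype ι] [Nonempty ι] (v w : NNReal) (hv : v ≠ 0) (hw : w ≠ 0) :
    ((Measure.pi (fun _ : ι => gaussianReal 0 v)).prod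
      (Measure.pi (fun _ : ι => gaussianReal 0 w))).map
      (fun p : (ι → ℝ) × (ι → ℝ) => fun i : ι =>
        Real.sqrt (∑ j, p.1 j ^ 2) * p.2 i / Real.sqrt (∑ j, p.2 j ^ 2)) =
      Measure.pi (fun _ : ι => gaussianReal 0 v) := by
  set H : NNReal → ℝ → ENNReal := fun v s =>
    ENNReal.ofReal (((Real.sqrt (2 * Real.pi * v))⁻¹) ^ (Fintype.card ι) *
          Real.exp (-(s ^ 2) / (2 * v))) with hH
  have hHm : ∀ v, Measurable (H v) := fun v => by simp only [hH]; fun_prop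
  have hm : Measurable (fun p : (ι → ℝ) × (ι → ℝ) => fun i : ι =>
        Real.sqrt (∑ j, p.1 j ^ 2) * p.2 i / Real.sqrt (∑ j, p.2 j ^ 2)) := by
    fun_prop
  have hnorm : ∀ x : EuclideanSpace ℝ ι, Real.sqrt (∑ j, x j ^ 2) = ‖x‖ := by
    intro x
    simp [EuclideanSpace.norm_eq]
  have hnorm2 : ∀ x : EuclideanSpace ℝ ι, (∑ j, x j ^ 2) = ‖x‖ ^ 2 := by
    intro x
    simp [EuclideanSpace.norm_sq_eq]
  -- integrals against the Gaussian product as integrals on Euclidean space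
  have key : ∀ (u : NNReal), u ≠ 0 → ∀ F : (ι → ℝ) → ENNReal, Measurable F →
      ∫⁻ x, F x ∂(Measure.pi (fun _ : ι => gaussianReal 0 u)) =
        ∫⁻ x : EuclideanSpace ℝ ι, H u ‖x‖ * F (WithLp.ofLp x) := by
    intro u hu F hF
    rw [aux_pi_density u hu, lintegral_withDensity_eq_lintegral_mul _ (by fun_prop) hF,
      ← (PiLp.volume_preserving_toLp ι).lintegral_comp (by fun_prop)]
    refine lintegral_congr fun x => ?_
    simp only [Pi.mul_apply, hH]
    rw [← hnorm2]
  refine Measure.ext_of_lintegral _ fun F hF => ?_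
  rw [lintegral_map hF hm, lintegral_prod _ (by fun_prop), key v hv _ (by
    exact (hF.comp hm).lintegral_prod_right'), key v hv F hF]
  have hin : ∀ x : EuclideanSpace ℝ ι,
      ∫⁻ y, F (fun i => Real.sqrt (∑ j, x j ^ 2) * y i / Real.sqrt (∑ j, y j ^ 2))
        ∂(Measure.pi (fun _ : ι => gaussianReal 0 w)) =
      ∫⁻ y : EuclideanSpace ℝ ι, H w ‖y‖ * (fun z : EuclideanSpace ℝ ι => F (WithLp.ofLp z))
        ((‖x‖ / ‖y‖) • y) := by
    intro x
    rw [key w hw _ (by fun_prop)]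
    refine lintegral_congr fun y => ?_
    congr 2
    funext i
    simp only [hnorm]
    simp
    ring
  simp only [hin]
  refine (aux_radial volume (H v) (H w) (hHm v) (hHm w)
    (fun z : EuclideanSpace ℝ ι => F (WithLp.ofLp z)) (by fun_prop)).trans ?_
  have h1 := key w hw (fun _ => 1) measurable_const
  simp only [lintegral_const, measure_univ, mul_one] at h1
  rw [← h1, one_mul]

namespace PPT

/-- mean vector orthogonal to null eigenvectors -/
theorem aux_mean {n d : ℕ} (X : Fin n → Fin d → ℝ)
    (r : ℕ) (hr : r = Set.ncard (Set.range fun i => X i))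
    (f0 : (Fin d → ℝ) → ℝ)
    (K : (Fin d → ℝ) → (Fin d → ℝ) → ℝ)
    (Kn : Fin n → Fin n → ℝ) (hKn : ∀ i j, Kn i j = K (X i) (X j))
    (hrank : (Matrix.of Kn).rank = r)
    (Γ : Fin n → Fin n → ℝ) (c : Fin n → ℝ) (hEig : IsEigenDecomp Kn Γ c)
    (k : Fin n) (hk : r ≤ (k : ℕ)) : ∑ j, Γ j k * f0 (X j) = 0 := by
  obtain ⟨hO, hdec, hmono, hpos⟩ := hEig
  set M : Matrix (Fin n) (Fin n) ℝ := Matrix.of Γ with hM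
  have hMM : M * M.transpose = 1 := by
    ext i j
    simp [Matrix.mul_apply, Matrix.one_apply, hM, hO i j]
  have hMM' : M.transpose * M = 1 := mul_eq_one_comm.1 hMM
  have hcol : ∀ a b, ∑ i, Γ i a * Γ i b = if a = b then (1:ℝ) else 0 := by
    intro a b
    have := congrFun (congrFun hMM' a) b
    simpa [Matrix.mul_apply, Matrix.one_apply, hM] using this
  have hKd : Matrix.of Kn = M * Matrix.diagonal c * M.transpose := by
    ext i j
    rw [Matrix.mul_apply]
    simp [Matrix.mul_diagonal, hdec i j, hM]
  -- the eigenvalue vanishes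
  have hck : c k = 0 := by
    have hdetM : IsUnit M.det := by
      have := congrArg Matrix.det hMM
      rw [Matrix.det_mul, Matrix.det_one] at this
      exact IsUnit.of_mul_eq_one _ this
    have hdetMt : IsUnit M.transpose.det := by rwa [Matrix.det_transpose]
    have hrd : (Matrix.diagonal c).rank = r := by
      rw [← hrank, hKd, Matrix.rank_mul_eq_left_of_isUnit_det _ _ hdetMt,
        Matrix.rank_mul_eq_right_of_isUnit_det _ _ hdetM]
    rw [Matrix.rank_diagonal] at hrd
    by_contra hne
    have hckpos : 0 < c k := lt_of_le_of_ne (hpos k) (Ne.symm hne)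
    have hsub : (Finset.univ.filter fun i : Fin n => i ≤ k) ⊆
        Finset.univ.filter fun i : Fin n => c i ≠ 0 := by
      intro i hi
      simp only [Finset.mem_filter, Finset.mem_univ, true_and] at hi ⊢
      exact ne_of_gt (hckpos.trans_le (hmono i k hi))
    have h1 := Finset.card_le_card hsub
    rw [Fintype.card_subtype] at hrd
    rw [hrd] at h1
    have h2 : (Finset.univ.filter fun i : Fin n => i ≤ k) = Finset.Iic k := by
      ext; simp
    rw [h2, Fin.card_Iic] at h1
    omega
  -- the mean vector is in the column space of the kernel matrix
  let R := Set.range fun i => X i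
  have hRfin : R.Finite := Set.finite_range _
  have : Fintype R := hRfin.fintype
  let L : (R → ℝ) →ₗ[ℝ] (Fin n → ℝ) :=
    { toFun := fun a i => a ⟨X i, i, rfl⟩
      map_add' := fun _ _ => rfl
      map_smul' := fun _ _ => rfl }
  have hle : LinearMap.range (Matrix.of Kn).mulVecLin ≤ LinearMap.range L := by
    rintro _ ⟨a, rfl⟩
    refine ⟨fun x => ∑ j, K x.1 (X j) * a j, ?_⟩
    funext i
    simp [L, Matrix.mulVec, dotProduct, hKn]
  have hdim : Module.finrank ℝ (LinearMap.range L) ≤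
      Module.finrank ℝ (LinearMap.range (Matrix.of Kn).mulVecLin) := by
    refine (LinearMap.finrank_range_le L).trans ?_
    have h3 : Module.finrank ℝ (LinearMap.range (Matrix.of Kn).mulVecLin) = r := hrank
    rw [h3, hr, Module.finrank_fintype_fun_eq_card, ← Nat.card_eq_fintype_card]
    exact le_of_eq rfl
  have heq := Submodule.eq_of_le_of_finrank_le hle hdim
  have hmem : (fun i => f0 (X i)) ∈ LinearMap.range (Matrix.of Kn).mulVecLin := by
    rw [heq]
    exact ⟨fun x => f0 x.1, rfl⟩
  obtain ⟨a, ha⟩ := hmem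
  have ha' : ∀ j, f0 (X j) = ∑ i, Kn j i * a i := by
    intro j
    have := congrFun ha j
    simpa [Matrix.mulVec, dotProduct] using this.symm
  have hz : ∀ i, ∑ j, Γ j k * Kn j i = 0 := by
    intro i
    calc ∑ j, Γ j k * Kn j i = ∑ j, ∑ l, (Γ j k * Γ j l) * (c l * Γ i l) := by
          refine Finset.sum_congr rfl fun j _ => ?_
          rw [hdec, Finset.mul_sum]
          exact Finset.sum_congr rfl fun l _ => by ring
      _ = ∑ l, (∑ j, Γ j k * Γ j l) * (c l * Γ i l) := by
          rw [Finset.sum_comm]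
          simp_rw [Finset.sum_mul]
      _ = 0 := by
          simp [hcol, hck]
  calc ∑ j, Γ j k * f0 (X j) = ∑ i, (∑ j, Γ j k * Kn j i) * a i := by
        simp_rw [ha', Finset.mul_sum, Finset.sum_mul]
        rw [Finset.sum_comm]
        exact Finset.sum_congr rfl fun i _ => Finset.sum_congr rfl fun j _ => by ring
    _ = 0 := by simp [hz]

theorem aux_perm {n : ℕ} (m : Fin n → ℝ) (v : NNReal) (ψ : Equiv.Perm (Fin n))
    (hψ : ∀ i, m (ψ i) = m i) :
    (Measure.pi (fun i => gaussianReal (m i) v)).map (fun w : Fin n → ℝ => w ∘ ψ) =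
      Measure.pi (fun i => gaussianReal (m i) v) := by
  refine (Measure.pi_eq fun s hs => ?_).symm
  rw [Measure.map_apply (by fun_prop) (MeasurableSet.univ_pi hs)]
  have : (fun w : Fin n → ℝ => w ∘ ψ) ⁻¹' Set.univ.pi s = Set.univ.pi (fun i => s (ψ.symm i)) := by
    ext w
    simp only [Set.mem_preimage, Set.mem_pi, Set.mem_univ, true_implies, Function.comp]
    constructor
    · intro h i
      simpa using h (ψ.symm i)
    · intro h i
      simpa using h (ψ i)
  rw [this, Measure.pi_pi]
  rw [← Equiv.prod_comp ψ]
  simp [hψ]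

theorem aux_disc {n : ℕ} (b : ℕ) (m : Fin n → ℝ) (v : NNReal)
    (hm : ∀ i : Fin n, n - b ≤ (i : ℕ) → m i = 0)
    (S : (Fin n → ℝ) → ℝ) (hS : Measurable S) (α : ℝ) :
    (Measure.pi (fun i => gaussianReal (m i) v))
      {w | ((permSet n b).card : ℝ)⁻¹ * ∑ ψ ∈ permSet n b,
        (if S w ≤ S (w ∘ ψ) then (1:ℝ) else 0) ≤ α} ≤ ENNReal.ofReal α := by
  classical
  let _ : MeasurableSpace (Equiv.Perm (Fin n)) := ⊤
  have : MeasurableSingletonClass (Equiv.Perm (Fin n)) := ⟨fun _ => trivial⟩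
  set P : Set (Equiv.Perm (Fin n)) := ↑(permSet n b) with hP
  have hPmem : ∀ ψ, ψ ∈ P ↔ ∀ i : Fin n, (i : ℕ) < n - b → ψ i = i := by
    intro ψ; simp [hP, permSet]
  have hne : P.Nonempty := ⟨1, by simp [hPmem]⟩
  have hPfin : P.Finite := Set.toFinite _
  set q : Measure (Equiv.Perm (Fin n)) := uniformOn P with hq
  have : IsProbabilityMeasure q := isProbabilityMeasure_uniformOn hPfin hne
  have hqv : ∀ t : Set (Equiv.Perm (Fin n)), q t = (Measure.count P)⁻¹ * Measure.count (P ∩ t) := by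
    intro t
    rw [hq, uniformOn, cond_apply hPfin.measurableSet]
  have hmem_ae : ∀ᵐ ψ ∂q, ψ ∈ P := ae_cond_mem hPfin.measurableSet
  have hmψ : ∀ ψ ∈ P, ∀ i, m (ψ i) = m i := by
    intro ψ hψ i
    rw [hPmem] at hψ
    by_cases hi : (i : ℕ) < n - b
    · rw [hψ i hi]
    · have : n - b ≤ (ψ i : ℕ) := by
        by_contra hcon
        push Not at hcon
        have := ψ.injective (hψ _ hcon)
        rw [this] at hcon
        exact hi hcon
      rw [hm _ this, hm _ (not_lt.1 hi)]
  have hA : Measurable (Function.uncurry fun (w : Fin n → ℝ) (ψ : Equiv.Perm (Fin n)) => w ∘ ψ) := by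
    refine measurable_from_prod_countable_left fun ψ => ?_
    simp only [Function.uncurry]
    fun_prop
  have key := aux_valid (Measure.pi (fun i => gaussianReal (m i) v)) q
    (fun w ψ => w ∘ ψ) hA ?_ S hS ?_ α
  · refine le_trans (le_of_eq ?_) key
    congr 1
    ext w
    simp only [Set.mem_ofPred_eq]
    rw [hqv, hP, Measure.count_apply_finset]
    have : (↑(permSet n b) ∩ {g : Equiv.Perm (Fin n) | S w ≤ S (w ∘ ⇑g)}) =
        (((permSet n b).filter fun ψ : Equiv.Perm (Fin n) => S w ≤ S (w ∘ ψ) :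
          Finset (Equiv.Perm (Fin n))) : Set (Equiv.Perm (Fin n))) := by
      ext; simp
    rw [this, Measure.count_apply_finset, Finset.sum_boole]
    simp
  · ext B hB
    rw [Measure.map_apply hA hB, Measure.prod_apply_symm (hA hB)]
    calc _ = ∫⁻ ψ, (Measure.pi (fun i => gaussianReal (m i) v)) B ∂q := by
          refine lintegral_congr_ae ?_
          filter_upwards [hmem_ae] with ψ hψ
          conv_rhs => rw [← aux_perm m v ψ (hmψ ψ hψ), Measure.map_apply (by fun_prop) hB]
          rfl
      _ = _ := by simp
  · intro w
    filter_upwards [hmem_ae] with ψ hψ s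
    rw [hqv, hqv]
    congr 1
    rw [← Measure.count_injective_image (f := fun φ => ψ * φ) (mul_right_injective ψ)]
    congr 1
    rw [hPmem] at hψ
    have hψ' : ∀ i : Fin n, (i : ℕ) < n - b → ψ.symm i = i := by
      intro i hi
      rw [Equiv.symm_apply_eq, hψ i hi]
    ext φ
    simp only [Set.mem_image, Set.mem_inter_iff, hPmem, Set.mem_ofPred_eq]
    constructor
    · rintro ⟨φ', ⟨h1, h2⟩, rfl⟩
      refine ⟨fun i hi => ?_, ?_⟩
      · simp [h1 i hi, hψ i hi]
      · simpa [Function.comp_assoc, Equiv.Perm.coe_mul] using h2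
    · rintro ⟨h1, h2⟩
      refine ⟨ψ⁻¹ * φ, ⟨fun i hi => ?_, ?_⟩, by simp⟩
      · simp [h1 i hi, hψ' i hi]
      · rw [Function.comp_assoc, ← Equiv.Perm.coe_mul]
        simpa using h2

theorem aux_tail_sum {n : ℕ} (b : ℕ) (w : Fin n → ℝ) :
    tailNormSq b w = ∑ j : {i : Fin n // ¬ ((i : ℕ) < n - b)}, w j ^ 2 := by
  unfold tailNormSq
  refine Finset.sum_subtype _ (fun i => ?_) _
  simp

theorem aux_tail_nonneg {n : ℕ} (b : ℕ) (w : Fin n → ℝ) : 0 ≤ tailNormSq b w :=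
  Finset.sum_nonneg fun _ _ => sq_nonneg _

theorem aux_tail_wStar {n : ℕ} (b : ℕ) (w g : Fin n → ℝ) (hg : tailNormSq b g ≠ 0) :
    tailNormSq b (wStar b w g) = tailNormSq b w := by
  have hgp : 0 < tailNormSq b g := lt_of_le_of_ne (aux_tail_nonneg b g) (Ne.symm hg)
  have h1 : tailNormSq b (wStar b w g) =
      ∑ i ∈ Finset.univ.filter (fun i : Fin n => n - b ≤ (i : ℕ)),
        tailNormSq b w / tailNormSq b g * g i ^ 2 := by
    conv_lhs => unfold tailNormSq
    refine Finset.sum_congr rfl fun i hi => ?_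
    simp only [Finset.mem_filter, Finset.mem_univ, true_and] at hi
    have hni : ¬ ((i : ℕ) < n - b) := not_lt.2 hi
    simp only [wStar, if_neg hni]
    rw [div_pow, mul_pow, Real.sq_sqrt (aux_tail_nonneg b w), Real.sq_sqrt (aux_tail_nonneg b g)]
    ring
  rw [h1, ← Finset.mul_sum]
  change tailNormSq b w / tailNormSq b g * tailNormSq b g = _
  rw [div_mul_cancel₀ _ hg]

theorem aux_wStar_wStar {n : ℕ} (b : ℕ) (w g g' : Fin n → ℝ) (hg : tailNormSq b g ≠ 0) :
    wStar b (wStar b w g) g' = wStar b w g' := by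
  funext i
  by_cases hi : (i : ℕ) < n - b
  · simp [wStar, hi]
  · have := aux_tail_wStar b w g hg
    conv_lhs => unfold wStar
    conv_rhs => unfold wStar
    simp only [if_neg hi]
    change Real.sqrt (tailNormSq b (wStar b w g)) * _ / _ = _
    rw [this]

theorem aux_wStar_meas {n : ℕ} (b : ℕ) :
    Measurable (Function.uncurry (wStar (n := n) b)) := by
  refine measurable_pi_lambda _ fun i => ?_
  by_cases hi : (i : ℕ) < n - b
  · simp only [Function.uncurry, wStar, if_pos hi]
    fun_prop
  · simp only [Function.uncurry, wStar, if_neg hi, tailNormSq]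
    fun_prop

theorem aux_wStar_inv {n : ℕ} (hn : 1 ≤ n) (b : ℕ) (hb : 1 ≤ b) (m : Fin n → ℝ) (v : NNReal)
    (hv : v ≠ 0) (hm : ∀ i : Fin n, n - b ≤ (i : ℕ) → m i = 0) :
    ((Measure.pi (fun i => gaussianReal (m i) v)).prod (stdGaussianPi n)).map
      (Function.uncurry (wStar b)) = Measure.pi (fun i => gaussianReal (m i) v) := by
  let p : Fin n → Prop := fun i => (i : ℕ) < n - b
  let e := MeasurableEquiv.piEquivPiSubtypeProd (fun _ : Fin n => ℝ) p
  have : Nonempty {i // ¬ p i} := ⟨⟨⟨n - 1, by omega⟩, by simp only [p]; omega⟩⟩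
  have he1 := measurePreserving_piEquivPiSubtypeProd (fun i => gaussianReal (m i) v) p
  have he2 := measurePreserving_piEquivPiSubtypeProd (fun _ : Fin n => gaussianReal 0 1) p
  have h2 : (Measure.pi fun i : {i // ¬ p i} => gaussianReal (m i) v) =
      Measure.pi fun i : {i // ¬ p i} => gaussianReal 0 v := by
    congr 1
    funext i
    rw [hm i.1 (not_lt.1 i.2)]
  rw [h2] at he1
  have hs : MeasurePreserving
      (fun p' : ({i // ¬ p i} → ℝ) × ({i // ¬ p i} → ℝ) => fun i : {i // ¬ p i} =>
        Real.sqrt (∑ j, p'.1 j ^ 2) * p'.2 i / Real.sqrt (∑ j, p'.2 j ^ 2))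
      ((Measure.pi fun i : {i // ¬ p i} => gaussianReal 0 v).prod
        (Measure.pi fun i : {i // ¬ p i} => gaussianReal 0 1))
      (Measure.pi fun i : {i // ¬ p i} => gaussianReal 0 v) :=
    ⟨by fun_prop, aux_sphere v 1 hv one_ne_zero⟩
  have hsnd := (measurePreserving_snd (μ := Measure.pi fun i : {i // p i} => gaussianReal 0 1)
    (ν := Measure.pi fun i : {i // ¬ p i} => gaussianReal 0 1)).comp he2
  have hA := he1.prod hsnd
  have hB := (measurePreserving_prodAssoc (Measure.pi fun i : {i // p i} => gaussianReal (m i) v)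
    (Measure.pi fun i : {i // ¬ p i} => gaussianReal 0 v)
    (Measure.pi fun i : {i // ¬ p i} => gaussianReal 0 1)).comp hA
  have hC := ((MeasurePreserving.id (Measure.pi fun i : {i // p i} =>
    gaussianReal (m i) v)).prod hs).comp hB
  have hD := (he1.symm e).comp hC
  have hE := hD.map_eq
  refine Eq.trans ?_ hE
  unfold stdGaussianPi
  congr 1
  funext x
  funext i
  by_cases hi : p i
  · simp [e, Function.uncurry, wStar, MeasurableEquiv.piEquivPiSubtypeProd, 
      Equiv.piEquivPiSubtypeProd, MeasurableEquiv.prodAssoc, hi]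
    intro h
    have hi' : (i : ℕ) < n - b := hi
    omega
  · have hi' : ¬ ((i : ℕ) < n - b) := hi
    simp only [Function.uncurry, wStar, if_neg hi', aux_tail_sum]
    simp [e, MeasurableEquiv.piEquivPiSubtypeProd, 
      Equiv.piEquivPiSubtypeProd, MeasurableEquiv.prodAssoc, hi]
    rfl

theorem aux_cont {n : ℕ} (hn : 1 ≤ n) (b : ℕ) (hb : 1 ≤ b) (m : Fin n → ℝ) (v : NNReal)
    (hv : v ≠ 0) (hm : ∀ i : Fin n, n - b ≤ (i : ℕ) → m i = 0)
    (S : (Fin n → ℝ) → ℝ) (hS : Measurable S) (α : ℝ) :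
    (Measure.pi (fun i => gaussianReal (m i) v))
      {w | (stdGaussianPi n {g | S w ≤ S (wStar b w g)}).toReal ≤ α} ≤ ENNReal.ofReal α := by
  have : IsProbabilityMeasure (stdGaussianPi n) := by unfold stdGaussianPi; infer_instance
  have hae : ∀ᵐ g ∂(stdGaussianPi n), tailNormSq b g ≠ 0 := by
    let i0 : Fin n := ⟨n - 1, by omega⟩
    have h1 : ∀ᵐ x ∂(gaussianReal 0 1), x ≠ 0 := by
      have := nullSingletonClass_gaussianReal (μ := 0) (v := 1) one_ne_zero
      rw [ae_iff]
      simp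
    have h2 := (measurePreserving_eval (fun _ : Fin n => gaussianReal 0 1) i0).quasiMeasurePreserving.ae h1
    filter_upwards [h2] with g hg h0
    have := (Finset.sum_eq_zero_iff_of_nonneg (fun i _ => sq_nonneg (g i))).1 h0 i0 (by
      simp only [Finset.mem_filter, Finset.mem_univ, true_and, i0]; omega)
    exact hg (by simpa using this)
  refine aux_valid _ (stdGaussianPi n) (wStar b) (aux_wStar_meas b)
    (aux_wStar_inv hn b hb m v hv hm) S hS ?_ α
  intro w
  filter_upwards [hae] with g hg s
  simp only [aux_wStar_wStar b w g _ hg]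

end PPT

open PPT in
/-- Corollary 3: with exactly balanced covariates across all groups and a
kernel matrix of full rank `r` (the number of distinct covariate values), the discrete and
continuous partial permutation p-values are valid for an arbitrary regression function. -/
theorem partial_permutation_valid_balanced
    {n d H : ℕ} (hn : 1 ≤ n) (hH : 1 ≤ H)
    (X : Fin n → Fin d → ℝ) (Z : Fin n → Fin H)
    -- exactly balanced design: the multiset of covariate values is the same in every group
    (hbal : ∀ h h' : Fin H,
      ((Finset.univ.filter fun i => Z i = h).val.map fun i => X i) =
      ((Finset.univ.filter fun i => Z i = h').val.map fun i => X i))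
    -- r is the number of distinct covariate values, and r ≤ n / H
    (r : ℕ) (hr : r = Set.ncard (Set.range fun i => X i)) (hrH : r * H ≤ n)
    -- the true functional relationship, an arbitrary measurable function
    (f0 : (Fin d → ℝ) → ℝ) (hf0 : Measurable f0)
    -- noise level
    (σ0 : ℝ) (hσ0 : 0 < σ0)
    -- the law of Y = f0(X) + ε with ε ~ N(0, σ0² Iₙ)
    (μY : Measure (Fin n → ℝ))
    (hμY : μY = Measure.map (fun ε : Fin n → ℝ => fun i => f0 (X i) + ε i) (noiseLaw n σ0))
    -- a symmetric positive semidefinite kernel and its sample kernel matrix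
    (K : (Fin d → ℝ) → (Fin d → ℝ) → ℝ) (hK : IsPSDKernel K)
    (Kn : Fin n → Fin n → ℝ) (hKn : ∀ i j, Kn i j = K (X i) (X j))
    -- the kernel matrix has full rank r
    (hrank : (Matrix.of Kn).rank = r)
    -- a fixed eigendecomposition Kn = Γ diag(c) Γᵀ
    (Γ : Fin n → Fin n → ℝ) (c : Fin n → ℝ) (hEig : IsEigenDecomp Kn Γ c)
    -- permutation size
    (b : ℕ) (hb1 : 1 ≤ b) (hb2 : b ≤ n - r)
    -- arbitrary (measurable) test statistic
    (T : (Fin n → Fin d → ℝ) → (Fin n → ℝ) → (Fin n → Fin H) → ℝ)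
    (hT : Measurable fun y => T X y Z) :
    ∀ α ∈ Set.Ioo (0 : ℝ) 1,
      μY {y | pDisc X Z T Γ b y ≤ α} ≤ ENNReal.ofReal α ∧
      μY {y | pCont X Z T Γ b y ≤ α} ≤ ENNReal.ofReal α := by
  intro α _
  have hOrth := hEig.1
  set M : Matrix (Fin n) (Fin n) ℝ := Matrix.of Γ with hM
  have hMM : M * M.transpose = 1 := by
    ext i j
    simp [Matrix.mul_apply, Matrix.one_apply, hM, hOrth i j]
  have hmv : ∀ w, mulVecF Γ w = M.mulVec w := fun w => rfl
  have htmv : ∀ w, tmulVecF Γ w = M.transpose.mulVec w := fun w => rfl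
  have hcancel : ∀ y, mulVecF Γ (tmulVecF Γ y) = y := by
    intro y
    rw [hmv, htmv, Matrix.mulVec_mulVec, hMM, Matrix.one_mulVec]
  have hmeas : Measurable (tmulVecF Γ) := by
    simp only [funext htmv]; fun_prop
  have hmeas' : Measurable (mulVecF Γ) := by
    simp only [funext hmv]; fun_prop
  set v : NNReal := (σ0 ^ 2).toNNReal with hv
  have hv0 : v ≠ 0 := by
    rw [hv]; exact (Real.toNNReal_pos.2 (by positivity)).ne'
  set m : Fin n → ℝ := fun i => ∑ j, Γ j i * f0 (X j) with hmdef
  have hm : ∀ i : Fin n, n - b ≤ (i : ℕ) → m i = 0 := by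
    intro i hi
    have hin := i.2
    exact aux_mean X r hr f0 K Kn hKn hrank Γ c hEig i (by omega)
  have hlaw : μY.map (tmulVecF Γ) = Measure.pi (fun i => gaussianReal (m i) v) := by
    rw [hμY, Measure.map_map hmeas (by fun_prop)]
    have h1 : (tmulVecF Γ ∘ fun ε : Fin n → ℝ => fun i => f0 (X i) + ε i) =
        (fun x : Fin n → ℝ => fun i => m i + x i) ∘ (fun x => M.transpose.mulVec x) := by
      funext ε i
      simp [tmulVecF, hmdef, Matrix.mulVec, dotProduct, hM, mul_add, Finset.sum_add_distrib]
    have h2 : (noiseLaw n σ0).map (fun x => M.transpose.mulVec x) =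
        Measure.pi (fun _ : Fin n => gaussianReal 0 v) :=
      aux_rot M.transpose (by rw [Matrix.transpose_transpose, hMM]) v hv0
    rw [h1, ← Measure.map_map (by fun_prop) (by fun_prop), h2]
    have h3 : ∀ i, (gaussianReal 0 v).map (fun x => m i + x) = gaussianReal (m i) v := by
      intro i
      rw [gaussianReal_map_const_add, zero_add]
    have h4 : ∀ i, SigmaFinite ((gaussianReal 0 v).map (fun x => m i + x)) := by
      intro i; rw [h3]; infer_instance
    rw [Measure.pi_map_pi (f := fun i x => m i + x) (fun i => by fun_prop)]
    simp only [h3]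
  set S : (Fin n → ℝ) → ℝ := fun w => T X (mulVecF Γ w) Z with hSdef
  have hS : Measurable S := hT.comp hmeas'
  have hTS : ∀ y, T X y Z = S (tmulVecF Γ y) := by
    intro y; simp only [hSdef, hcancel]
  constructor
  · have h := aux_disc b m v hm S hS α
    rw [← hlaw] at h
    refine le_trans ?_ ((Measure.le_map_apply hmeas.aemeasurable _).trans h)
    refine le_of_eq ?_
    congr 1
    ext y
    simp only [Set.mem_preimage, Set.mem_ofPred_eq, pDisc, hTS y, hSdef]
  · have h := aux_cont hn b hb1 m v hv0 hm S hS α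
    rw [← hlaw] at h
    refine le_trans ?_ ((Measure.le_map_apply hmeas.aemeasurable _).trans h)
    refine le_of_eq ?_
    congr 1
    ext y
    simp only [Set.mem_preimage, Set.mem_ofPred_eq, pCont, hTS y, hSdef]
end
end
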